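/- Let 𝔤 be a symmetrizable Kac–Moody algebra and λ, μ, ν dominant integral weights. Then the multiplicity of V(ν) in V(λ) ⊗ V(μ) equals the dimension of the space of vectors v in the (ν−λ)-weight space of V(μ) satisfying e_i^{λ(α_i^∨)+1}·v = 0 for all simple root vectors e_i. -/

import Mathlib

open TensorProduct

/-- A symmetrizable generalized Cartan matrix. -/
structure GCM (ι : Type) [Fintype ι] [DecidableEq ι] where
  A : ι → ι → ℤ
  diag : ∀ i, A i i = 2
  offdiag : ∀ i j, i ≠ j → A i j ≤ 0
  zero_iff : ∀ i j, A i j = 0 → A j i = 0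
  symmetrizable : ∃ d : ι → ℚ, (∀ i, 0 < d i) ∧ ∀ i j, d i * (A i j : ℚ) = d j * (A j i : ℚ)

/-- A realization of the (symmetrizable) Kac–Moody algebra with generalized Cartan
matrix `C` on a Lie algebra `𝔤` over `ℂ`: a Cartan subalgebra `H`, Chevalley
generators `e i`, `f i`, simple coroots `coroot i ∈ H`, satisfying the standard
Kac–Moody relations (including the Serre relations), and generating `𝔤`. -/
structure KacMoodyRealization (ι : Type) [Fintype ι] [DecidableEq ι] (C : GCM ι)
    (𝔤 : Type) [LieRing 𝔤] [LieAlgebra ℂ 𝔤] where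
  H : LieSubalgebra ℂ 𝔤
  e : ι → 𝔤
  f : ι → 𝔤
  coroot : ι → H
  abelian : ∀ h h' : H, ⁅(h : 𝔤), (h' : 𝔤)⁆ = 0
  root_vec_e : ∀ (h : H) (j : ι), ∃ c : ℂ, ⁅(h : 𝔤), e j⁆ = c • e j
  root_vec_f : ∀ (h : H) (j : ι), ∃ c : ℂ, ⁅(h : 𝔤), f j⁆ = c • f j
  coroot_e : ∀ i j, ⁅(↑(coroot i) : 𝔤), e j⁆ = (C.A i j : ℂ) • e j
  coroot_f : ∀ i j, ⁅(↑(coroot i) : 𝔤), f j⁆ = (-(C.A i j) : ℂ) • f j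
  e_f : ∀ i j, ⁅e i, f j⁆ = if i = j then (↑(coroot i) : 𝔤) else 0
  serre_e : ∀ i j, i ≠ j → ((LieAlgebra.ad ℂ 𝔤 (e i)) ^ (1 - C.A i j).toNat) (e j) = 0
  serre_f : ∀ i j, i ≠ j → ((LieAlgebra.ad ℂ 𝔤 (f i)) ^ (1 - C.A i j).toNat) (f j) = 0
  generates : LieSubalgebra.lieSpan ℂ 𝔤 (Set.range e ∪ Set.range f ∪ (H : Set 𝔤)) = ⊤

variable {ι : Type} [Fintype ι] [DecidableEq ι] {C : GCM ι}
variable {𝔤 : Type} [LieRing 𝔤] [LieAlgebra ℂ 𝔤]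

/-- `M` is the integrable highest weight irreducible `𝔤`-module `V(λ)` with highest
weight vector `v`: `v` is nonzero, annihilated by all `e i`, an `H`-weight vector of
weight `lam`, the actions of all `e i`, `f i` are locally nilpotent, and `M` is
irreducible. -/
def IsIntegrableHW (R : KacMoodyRealization ι C 𝔤) (lam : Module.Dual ℂ R.H)
    (M : Type) [AddCommGroup M] [Module ℂ M] [LieRingModule 𝔤 M] [LieModule ℂ 𝔤 M]
    (v : M) : Prop :=
  v ≠ 0 ∧ (∀ i, ⁅R.e i, v⁆ = 0) ∧ (∀ h : R.H, ⁅(h : 𝔤), v⁆ = lam h • v) ∧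
    (∀ i, ∀ m : M, ∃ n : ℕ, ((LieModule.toEnd ℂ 𝔤 M (R.e i)) ^ n) m = 0) ∧
    (∀ i, ∀ m : M, ∃ n : ℕ, ((LieModule.toEnd ℂ 𝔤 M (R.f i)) ^ n) m = 0) ∧
    IsSimpleOrder (LieSubmodule ℂ 𝔤 M)

/-- `lam` is a dominant integral weight: it takes nonnegative integer values on all
simple coroots. -/
def DominantIntegral (R : KacMoodyRealization ι C 𝔤) (lam : Module.Dual ℂ R.H) : Prop :=
  ∀ i, ∃ n : ℕ, lam (R.coroot i) = n

/-- The space of `𝔤`-module homomorphisms `M → N`, as a submodule of the linear maps.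
Its dimension computes the multiplicity `m_{λ,μ}^ν` when `M = V(ν)`, `N = V(λ) ⊗ V(μ)`. -/
def gModHom (𝔤 : Type) [LieRing 𝔤] [LieAlgebra ℂ 𝔤]
    (M N : Type) [AddCommGroup M] [Module ℂ M] [LieRingModule 𝔤 M]
    [AddCommGroup N] [Module ℂ N] [LieRingModule 𝔤 N] [LieModule ℂ 𝔤 N] :
    Submodule ℂ (M →ₗ[ℂ] N) where
  carrier := {φ | ∀ (x : 𝔤) (m : M), φ ⁅x, m⁆ = ⁅x, φ m⁆}
  add_mem' := by
    intro a b ha hb x m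
    simp only [LinearMap.add_apply, ha x m, hb x m, lie_add]
  zero_mem' := by
    intro x m
    simp
  smul_mem' := by
    intro c a ha x m
    simp only [LinearMap.smul_apply, ha x m, lie_smul]

/-- The `χ`-weight space of a `𝔤`-module `M` with respect to the Cartan subalgebra
`R.H`. -/
noncomputable def hWeightSpace (R : KacMoodyRealization ι C 𝔤) (χ : Module.Dual ℂ R.H)
    (M : Type) [AddCommGroup M] [Module ℂ M] [LieRingModule 𝔤 M] [LieModule ℂ 𝔤 M] :
    Submodule ℂ M :=
  ⨅ h : R.H, LinearMap.ker (LieModule.toEnd ℂ 𝔤 M (h : 𝔤) - χ h • (1 : Module.End ℂ M))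

namespace KacMoody

set_option linter.unusedSectionVars false

/-- The free associative algebra on the lowering operators. -/
abbrev Free (ι : Type) := FreeAlgebra ℂ ι

/-- The generators of the free algebra. -/
noncomputable abbrev gen (i : ι) : Free ι := FreeAlgebra.ι ℂ i

/-- The monomial attached to a word. -/
noncomputable def wd (w : List ι) : Free ι := (w.map gen).prod

theorem basis_eq_wd (w : List ι) :
    FreeAlgebra.basisFreeMonoid ℂ ι (FreeMonoid.ofList w) = wd w := by
  simp [FreeAlgebra.basisFreeMonoid, FreeAlgebra.equivMonoidAlgebraFreeMonoid, wd]

@[simp] theorem wd_nil : wd ([] : List ι) = 1 := by simp [wd]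

theorem wd_cons (i : ι) (w : List ι) : wd (i :: w) = gen i * wd w := by simp [wd]

theorem wd_singleton (i : ι) : wd [i] = gen i := by simp [wd]

theorem wd_append (w w' : List ι) : wd (w ++ w') = wd w * wd w' := by simp [wd]

/-- The linear map on the free algebra with prescribed values on monomials. -/
noncomputable def wlift {M : Type*} [AddCommGroup M] [Module ℂ M] (g : List ι → M) :
    Free ι →ₗ[ℂ] M :=
  (FreeAlgebra.basisFreeMonoid ℂ ι).constr ℂ (fun w => g (FreeMonoid.toList w))

@[simp] theorem wlift_wd {M : Type*} [AddCommGroup M] [Module ℂ M] (g : List ι → M)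
    (w : List ι) : wlift g (wd w) = g w := by
  rw [← basis_eq_wd, wlift, Module.Basis.constr_basis]; rfl

/-- The span of the monomials whose words satisfy `P`. -/
noncomputable def wspan (P : List ι → Prop) : Submodule ℂ (Free ι) :=
  Submodule.span ℂ (wd '' {w | P w})

theorem wd_mem_wspan {P : List ι → Prop} {w : List ι} (h : P w) : wd w ∈ wspan P :=
  Submodule.subset_span ⟨w, h, rfl⟩

theorem map_mem_of_mem_wspan {M : Type*} [AddCommGroup M] [Module ℂ M] {P : List ι → Prop}
    {f : Free ι →ₗ[ℂ] M} {N : Submodule ℂ M} (h : ∀ w, P w → f (wd w) ∈ N)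
    {x : Free ι} (hx : x ∈ wspan P) : f x ∈ N := by
  have : wspan P ≤ N.comap f := by
    rw [wspan, Submodule.span_le]
    rintro _ ⟨w, hw, rfl⟩
    exact h w hw
  exact this hx

theorem mem_of_mem_wspan {P : List ι → Prop} {N : Submodule ℂ (Free ι)}
    (h : ∀ w, P w → wd w ∈ N) {x : Free ι} (hx : x ∈ wspan P) : x ∈ N :=
  map_mem_of_mem_wspan (f := LinearMap.id) h hx

theorem eq_of_mem_wspan {M : Type*} [AddCommGroup M] [Module ℂ M] {P : List ι → Prop}
    {f g : Free ι →ₗ[ℂ] M} (h : ∀ w, P w → f (wd w) = g (wd w))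
    {x : Free ι} (hx : x ∈ wspan P) : f x = g x := by
  have := map_mem_of_mem_wspan (f := f - g) (N := ⊥)
    (fun w hw => by simp [h w hw]) hx
  simpa [sub_eq_zero] using this

theorem mem_wspan_true (x : Free ι) : x ∈ wspan (fun _ : List ι => True) := by
  have h := (FreeAlgebra.basisFreeMonoid ℂ ι).mem_span x
  refine Submodule.span_mono ?_ h
  rintro _ ⟨w, rfl⟩
  exact ⟨FreeMonoid.toList w, trivial, (basis_eq_wd _).symm⟩

theorem map_mem_of_wd {M : Type*} [AddCommGroup M] [Module ℂ M]
    {f : Free ι →ₗ[ℂ] M} {N : Submodule ℂ M} (h : ∀ w, f (wd w) ∈ N) (x : Free ι) : f x ∈ N :=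
  map_mem_of_mem_wspan (fun w _ => h w) (mem_wspan_true x)

theorem hom_ext {M : Type*} [AddCommGroup M] [Module ℂ M] {f g : Free ι →ₗ[ℂ] M}
    (h : ∀ w, f (wd w) = g (wd w)) : f = g :=
  LinearMap.ext fun x => eq_of_mem_wspan (fun w _ => h w) (mem_wspan_true x)

/-- The subspace of elements of height `n`. -/
noncomputable abbrev height (ι : Type) (n : ℕ) : Submodule ℂ (Free ι) :=
  wspan (fun w : List ι => w.length = n)

/-- The subspace of elements of multidegree `β`. -/
noncomputable abbrev degree (β : Multiset ι) : Submodule ℂ (Free ι) :=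
  wspan (fun w : List ι => (w : Multiset ι) = β)

instance height_finite (n : ℕ) : FiniteDimensional ℂ (height ι n) := by
  have : Set.Finite {w : List ι | w.length = n} := List.finite_length_eq ι n
  exact FiniteDimensional.span_of_finite ℂ (this.image _)

theorem degree_le_height (β : Multiset ι) : degree β ≤ height ι β.card := by
  intro x hx
  refine mem_of_mem_wspan (fun w hw => wd_mem_wspan ?_) hx
  rw [← hw]; simp

theorem gen_mul_mem_height (i : ι) {n : ℕ} {x : Free ι} (hx : x ∈ height ι n) :
    gen i * x ∈ height ι (n + 1) :=
  map_mem_of_mem_wspan (f := LinearMap.mulLeft ℂ (gen i))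
    (fun w hw => by
      simp only [LinearMap.mulLeft_apply, ← wd_cons]
      exact wd_mem_wspan (by simp [hw])) hx

theorem gen_mem_height (i : ι) : gen i ∈ height ι 1 := by
  rw [← wd_singleton]; exact wd_mem_wspan rfl

theorem gen_mul_mem_degree (i : ι) {β : Multiset ι} {x : Free ι} (hx : x ∈ degree β) :
    gen i * x ∈ degree (i ::ₘ β) :=
  map_mem_of_mem_wspan (f := LinearMap.mulLeft ℂ (gen i))
    (fun w hw => by
      simp only [LinearMap.mulLeft_apply, ← wd_cons]
      exact wd_mem_wspan (by simp [← hw])) hx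

theorem mul_gen_mem_degree (i : ι) {β : Multiset ι} {x : Free ι} (hx : x ∈ degree β) :
    x * gen i ∈ degree (i ::ₘ β) :=
  map_mem_of_mem_wspan (f := LinearMap.mulRight ℂ (gen i))
    (fun w hw => by
      have : wd w * gen i = wd (w ++ [i]) := by simp [wd]
      simp only [LinearMap.mulRight_apply, this]
      exact wd_mem_wspan (by
        rw [← hw, ← Multiset.coe_add, add_comm]; simp)) hx

/-- Projection to the multidegree `β`. -/
noncomputable def pr (β : Multiset ι) : Free ι →ₗ[ℂ] Free ι :=
  wlift (fun w => if (w : Multiset ι) = β then wd w else 0)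

theorem pr_mem (β : Multiset ι) (x : Free ι) : pr β x ∈ degree β := by
  refine map_mem_of_wd (fun w => ?_) x
  simp only [pr, wlift_wd]
  split_ifs with h
  · exact wd_mem_wspan h
  · exact zero_mem _

theorem pr_of_mem {β : Multiset ι} {x : Free ι} (hx : x ∈ degree β) : pr β x = x :=
  eq_of_mem_wspan (f := pr β) (g := LinearMap.id) (fun w hw => by simp [pr, hw]) hx

theorem pr_of_mem_ne {β γ : Multiset ι} (h : γ ≠ β) {x : Free ι} (hx : x ∈ degree γ) :
    pr β x = 0 :=
  eq_of_mem_wspan (f := pr β) (g := 0) (fun w hw => by simp [pr, hw, h]) hx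

theorem mem_of_pr {N : Submodule ℂ (Free ι)} {x : Free ι} (h : ∀ β, pr β x ∈ N) : x ∈ N := by
  have key : ∀ x : Free ι, x ∈ Submodule.span ℂ (Set.range fun β => pr β x) := by
    classical
    intro x
    have : ∃ s : Finset (Multiset ι), ∀ t, s ⊆ t → x = ∑ β ∈ t, pr β x := by
      refine Submodule.span_induction (p := fun x _ => ∃ s : Finset (Multiset ι),
        ∀ t, s ⊆ t → x = ∑ β ∈ t, pr β x) ?_ ?_ ?_ ?_ (mem_wspan_true x)
      · rintro _ ⟨w, -, rfl⟩
        refine ⟨{(w : Multiset ι)}, fun t ht => ?_⟩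
        simp only [pr, wlift_wd]
        rw [Finset.sum_ite_eq]
        simp [Finset.singleton_subset_iff.1 ht]
      · exact ⟨∅, by simp⟩
      · rintro x y - - ⟨s, hs⟩ ⟨s', hs'⟩
        refine ⟨s ∪ s', fun t ht => ?_⟩
        simp only [map_add, Finset.sum_add_distrib]
        rw [← hs t (Finset.union_subset_left ht), ← hs' t (Finset.union_subset_right ht)]
      · rintro c x - ⟨s, hs⟩
        refine ⟨s, fun t ht => ?_⟩
        simp only [map_smul, ← Finset.smul_sum]
        rw [← hs t ht]
    obtain ⟨s, hs⟩ := this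
    have h : ∑ β ∈ s, pr β x ∈ Submodule.span ℂ (Set.range fun β => pr β x) :=
      Submodule.sum_mem _ fun β _ => Submodule.subset_span (Set.mem_range_self β)
    rwa [← hs s subset_rfl] at h
  refine Submodule.span_le.2 ?_ (key x)
  rintro _ ⟨β, rfl⟩
  exact h β

/-- The value on the `i`-th simple coroot of the sum of the simple roots in a word. -/
def arow (C : GCM ι) (i : ι) (w : List ι) : ℂ := (w.map (fun k => (C.A i k : ℂ))).sum

@[simp] theorem arow_nil (C : GCM ι) (i : ι) : arow C i [] = 0 := by simp [arow]

@[simp] theorem arow_cons (C : GCM ι) (i j : ι) (w : List ι) :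
    arow C i (j :: w) = C.A i j + arow C i w := by simp [arow]

theorem arow_perm (C : GCM ι) (i : ι) {w w' : List ι}
    (h : (w : Multiset ι) = (w' : Multiset ι)) : arow C i w = arow C i w' :=
  ((Multiset.coe_eq_coe.1 h).map _).sum_eq

/-- The diagonal operator with eigenvalue `arow C i w` on the monomial of `w`. -/
noncomputable def aop (C : GCM ι) (i : ι) : Free ι →ₗ[ℂ] Free ι :=
  wlift (fun w => arow C i w • wd w)

/-- Right-nested iterated brackets. -/
def br {L : Type*} [LieRing L] (e : ι → L) : List ι → L
  | [] => 0
  | [j] => e j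
  | j :: k :: w => ⁅e j, br e (k :: w)⁆

/-- The linear map sending a monomial to the corresponding right-nested iterated bracket. -/
noncomputable def nest {L : Type*} [LieRing L] [LieAlgebra ℂ L] (e : ι → L) : Free ι →ₗ[ℂ] L :=
  wlift (br e)

theorem nest_gen {L : Type*} [LieRing L] [LieAlgebra ℂ L] (e : ι → L) (i : ι) :
    nest e (gen i) = e i := by
  rw [← wd_singleton, nest, wlift_wd, br]

theorem br_cons {L : Type*} [LieRing L] (e : ι → L) (j : ι) {w : List ι} (hw : w ≠ []) :
    br e (j :: w) = ⁅e j, br e w⁆ := by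
  cases w with
  | nil => exact absurd rfl hw
  | cons k w => rfl

theorem nest_gen_mul {L : Type*} [LieRing L] [LieAlgebra ℂ L] (e : ι → L) (j : ι) {n : ℕ}
    {x : Free ι} (hx : x ∈ height ι (n + 1)) : nest e (gen j * x) = ⁅e j, nest e x⁆ := by
  refine eq_of_mem_wspan (f := nest e ∘ₗ LinearMap.mulLeft ℂ (gen j))
    (g := (LieAlgebra.ad ℂ L (e j) : L →ₗ[ℂ] L) ∘ₗ nest e) (fun w hw => ?_) hx
  have : w ≠ [] := by rintro rfl; simp at hw
  simp [nest, ← wd_cons, br_cons e j this]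

/-- Values on words of the operator describing the bracket of a nested bracket of raising
operators with the `i`-th lowering operator. -/
noncomputable def contractWord (C : GCM ι) (i : ι) : List ι → Free ι
  | [] => 0
  | [_] => 0
  | [j, k] => (if i = j then (C.A i k : ℂ) • gen k else 0) -
      if i = k then (C.A i j : ℂ) • gen j else 0
  | j :: k :: l :: w => gen j * contractWord C i (k :: l :: w) +
      if i = j then arow C i (k :: l :: w) • wd (k :: l :: w) else 0

/-- The operator describing the bracket of a nested bracket of raising operators with the `i`-th
lowering operator. -/
noncomputable def contract (C : GCM ι) (i : ι) : Free ι →ₗ[ℂ] Free ι := wlift (contractWord C i)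

theorem contractWord_cons (C : GCM ι) (i j : ι) {w : List ι} (hw : 2 ≤ w.length) :
    contractWord C i (j :: w) =
      gen j * contractWord C i w + if i = j then arow C i w • wd w else 0 := by
  match w, hw with
  | k :: l :: w, _ => rfl

theorem contract_gen_mul (C : GCM ι) (i j : ι) {n : ℕ} {x : Free ι} (hx : x ∈ height ι (n + 2)) :
    contract C i (gen j * x) = gen j * contract C i x + if i = j then aop C i x else 0 := by
  have := eq_of_mem_wspan (f := contract C i ∘ₗ LinearMap.mulLeft ℂ (gen j))
    (g := LinearMap.mulLeft ℂ (gen j) ∘ₗ contract C i + if i = j then aop C i else 0)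
    (fun w hw => ?_) hx
  · rw [LinearMap.comp_apply, LinearMap.add_apply] at this
    rw [← LinearMap.mulLeft_apply (R := ℂ), this]
    split_ifs <;> rfl
  · have h2 : 2 ≤ w.length := by omega
    simp only [LinearMap.comp_apply, LinearMap.mulLeft_apply, ← wd_cons, contract, wlift_wd,
      contractWord_cons C i j h2, LinearMap.add_apply]
    split_ifs <;> simp [aop]

theorem contract_gen_mul_gen (C : GCM ι) (i j k : ι) :
    contract C i (gen j * gen k) = (if i = j then (C.A i k : ℂ) • gen k else 0) -
      if i = k then (C.A i j : ℂ) • gen j else 0 := by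
  have : gen j * gen k = wd [j, k] := by simp [wd]
  rw [this, contract, wlift_wd, contractWord]

/-- Induction on words of length at least two. -/
theorem word_induction {p : List ι → Prop} (h2 : ∀ j k, p [j, k])
    (hs : ∀ j w, 2 ≤ w.length → p w → p (j :: w)) : ∀ w : List ι, 2 ≤ w.length → p w
  | [], h => by simp at h
  | [_], h => by simp at h
  | [j, k], _ => h2 j k
  | j :: k :: l :: w, _ => hs j _ (by simp) (word_induction h2 hs (k :: l :: w) (by simp))

/-- An operator is said to lower by `i` if it maps multidegree `β + i` to multidegree `β`
and vanishes on multidegrees not containing `i`. -/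
def Lowers (i : ι) (T : Free ι →ₗ[ℂ] Free ι) : Prop :=
  ∀ w : List ι, (∀ β : Multiset ι, i ::ₘ β = w → T (wd w) ∈ degree β) ∧ (i ∉ w → T (wd w) = 0)

theorem Lowers.mem {i : ι} {T : Free ι →ₗ[ℂ] Free ι} (hT : Lowers i T) {β : Multiset ι}
    {x : Free ι} (hx : x ∈ degree (i ::ₘ β)) : T x ∈ degree β :=
  map_mem_of_mem_wspan (fun w hw => (hT w).1 β hw.symm) hx

theorem Lowers.eq_zero {i : ι} {T : Free ι →ₗ[ℂ] Free ι} (hT : Lowers i T) {β : Multiset ι}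
    (hi : i ∉ β) {x : Free ι} (hx : x ∈ degree β) : T x = 0 :=
  eq_of_mem_wspan (f := T) (g := 0)
    (fun w hw => by simpa using (hT w).2 (by rw [← hw] at hi; simpa using hi)) hx

theorem Lowers.pr_comm {i : ι} {T : Free ι →ₗ[ℂ] Free ι} (hT : Lowers i T) (β : Multiset ι)
    (x : Free ι) : T (pr (i ::ₘ β) x) = pr β (T x) := by
  refine eq_of_mem_wspan (f := T ∘ₗ pr (i ::ₘ β)) (g := pr β ∘ₗ T) (fun w _ => ?_)
    (mem_wspan_true x)
  simp only [LinearMap.comp_apply]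
  by_cases h : i ∈ w
  · have hw := Multiset.cons_erase (s := (w : Multiset ι)) (a := i) (by simpa using h)
    set γ := (w : Multiset ι).erase i with hγ
    have h1 := (hT w).1 γ hw
    by_cases hβ : γ = β
    · subst hβ
      rw [pr_of_mem h1, pr_of_mem (wd_mem_wspan hw.symm)]
    · rw [pr_of_mem_ne hβ h1, pr_of_mem_ne (γ := i ::ₘ γ) (by simpa using hβ)
        (wd_mem_wspan hw.symm), map_zero]
  · rw [(hT w).2 h, pr_of_mem_ne (γ := (w : Multiset ι)) (fun hw => h ?_) (wd_mem_wspan rfl)]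
    · simp
    · have : i ∈ (w : Multiset ι) := by rw [hw]; simp
      simpa using this

theorem Lowers.height_mem {i : ι} {T : Free ι →ₗ[ℂ] Free ι} (hT : Lowers i T) {n : ℕ}
    {x : Free ι} (hx : x ∈ height ι (n + 1)) : T x ∈ height ι n := by
  refine map_mem_of_mem_wspan (fun w hw => ?_) hx
  by_cases h : i ∈ w
  · have hw' := Multiset.cons_erase (s := (w : Multiset ι)) (a := i) (by simpa using h)
    have := degree_le_height _ ((hT w).1 _ hw')
    have hc := congrArg Multiset.card hw'
    simp only [Multiset.card_cons, Multiset.coe_card, hw] at hc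
    convert this using 2
    omega
  · rw [(hT w).2 h]; exact zero_mem _

/-- Inductive step for lowering operators. -/
theorem lowers_step {i j : ι} {w : List ι} {y : Free ι} {a : ℂ}
    (h : (∀ β : Multiset ι, i ::ₘ β = w → y ∈ degree β) ∧ (i ∉ w → y = 0)) :
    (∀ β : Multiset ι, i ::ₘ β = (j :: w : List ι) →
      gen j * y + (if i = j then a • wd w else 0) ∈ degree β) ∧
    (i ∉ j :: w → gen j * y + (if i = j then a • wd w else 0) = 0) := by
  constructor
  · intro β hβ
    refine add_mem ?_ ?_
    · by_cases hi : i ∈ w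
      · have hw := Multiset.cons_erase (s := (w : Multiset ι)) (a := i) (by simpa using hi)
        have h1 := gen_mul_mem_degree j (h.1 _ hw)
        have : β = j ::ₘ (w : Multiset ι).erase i := by
          rw [← Multiset.cons_coe, ← hw, Multiset.cons_swap] at hβ
          exact (Multiset.cons_inj_right i).1 hβ
        rwa [this]
      · rw [h.2 hi]; simp
    · split_ifs with hij
      · subst hij
        rw [← Multiset.cons_coe, Multiset.cons_inj_right] at hβ
        exact Submodule.smul_mem _ _ (wd_mem_wspan hβ.symm)
      · exact zero_mem _
  · intro hi
    simp only [List.mem_cons, not_or] at hi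
    simp [h.2 hi.2, hi.1]

theorem lowers_contract (C : GCM ι) (i : ι) : Lowers i (contract C i) := by
  intro w
  simp only [contract, wlift_wd]
  match w with
  | [] => simp [contractWord]
  | [j] => simp [contractWord]
  | j :: k :: w =>
    refine word_induction (p := fun w => (∀ β : Multiset ι, i ::ₘ β = w →
      contractWord C i w ∈ degree β) ∧ (i ∉ w → contractWord C i w = 0)) ?_ ?_ (j :: k :: w) (by simp)
    · intro j k
      constructor
      · intro β hβ
        rw [contractWord]
        refine sub_mem ?_ ?_
        · split_ifs with h
          · subst h
            refine Submodule.smul_mem _ _ ?_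
            rw [← wd_singleton]
            rw [← Multiset.cons_coe, Multiset.cons_inj_right] at hβ
            exact wd_mem_wspan hβ.symm
          · exact zero_mem _
        · split_ifs with h
          · subst h
            refine Submodule.smul_mem _ _ ?_
            rw [← wd_singleton]
            rw [← Multiset.cons_coe, ← Multiset.cons_coe, Multiset.cons_swap,
              Multiset.cons_inj_right] at hβ
            exact wd_mem_wspan hβ.symm
          · exact zero_mem _
      · intro hi
        simp only [List.mem_cons, List.not_mem_nil, or_false, not_or] at hi
        simp [contractWord, hi.1, hi.2]
    · intro j w hw ih
      rw [contractWord_cons C i j hw]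
      exact lowers_step ih

section LieTriple

variable {L : Type*} [LieRing L] [LieAlgebra ℂ L] {e f h : ι → L}

theorem lie_nest (hhe : ∀ i j, ⁅h i, e j⁆ = (C.A i j : ℂ) • e j) (i : ι) (w : List ι) :
    ⁅h i, nest e (wd w)⁆ = arow C i w • nest e (wd w) := by
  simp only [nest, wlift_wd]
  induction w with
  | nil => simp [br]
  | cons j w ih =>
    rcases eq_or_ne w [] with rfl | hw
    · simp [br, hhe]
    · rw [br_cons e j hw, leibniz_lie, ih, hhe, smul_lie, lie_smul, arow_cons, add_smul]

theorem nest_lie (hef : ∀ i j, ⁅e i, f j⁆ = if i = j then h i else 0)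
    (hhe : ∀ i j, ⁅h i, e j⁆ = (C.A i j : ℂ) • e j) (i : ι) {n : ℕ} {x : Free ι}
    (hx : x ∈ height ι (n + 2)) : ⁅nest e x, f i⁆ = nest e (contract C i x) := by
  have key : ∀ w : List ι, 2 ≤ w.length → ⁅nest e (wd w), f i⁆ = nest e (contract C i (wd w)) := by
    refine word_induction (fun j k => ?_) (fun j w hw ih => ?_)
    · have h2 : wd [j, k] = gen j * gen k := by simp [wd]
      rw [h2, contract_gen_mul_gen, nest_gen_mul e j (n := 0) (gen_mem_height k), nest_gen,
        lie_lie, hef, hef, map_sub]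
      have h3 : ⁅e j, h i⁆ = -((C.A i j : ℂ) • e j) := by rw [← hhe, lie_skew]
      have h4 : ⁅e k, h i⁆ = -((C.A i k : ℂ) • e k) := by rw [← hhe, lie_skew]
      by_cases hk : k = i
      · subst hk
        by_cases hj : j = k
        · subst hj; simp [nest_gen]
        · simp [hj, Ne.symm hj, nest_gen, h3]
      · by_cases hj : j = i
        · subst hj
          simp [hk, Ne.symm hk, nest_gen, h4]
        · simp [hj, Ne.symm hj, hk, Ne.symm hk]
    · obtain ⟨n, hn⟩ : ∃ n, w.length = n + 2 := ⟨w.length - 2, by omega⟩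
      have hw' : wd w ∈ height ι (n + 2) := wd_mem_wspan hn
      rw [wd_cons, nest_gen_mul e j (n := n + 1) hw', contract_gen_mul C i j hw', lie_lie, ih, hef,
        map_add, nest_gen_mul e j (n := n) ((lowers_contract C i).height_mem hw'),
        sub_eq_add_neg, lie_skew]
      congr 1
      by_cases hj : j = i
      · subst hj
        simp [lie_nest hhe, aop]
      · simp [hj, Ne.symm hj]
  refine eq_of_mem_wspan (f := (-(LieAlgebra.ad ℂ L (f i) : L →ₗ[ℂ] L)) ∘ₗ nest e)
    (g := nest e ∘ₗ contract C i) (fun w hw => ?_) hx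
    |> fun h => by simpa using h
  simpa using key w (by omega)

end LieTriple

/-- The symmetrizing factors of a symmetrizable generalized Cartan matrix. -/
noncomputable def sym (C : GCM ι) (i : ι) : ℂ := (C.symmetrizable.choose i : ℂ)

theorem sym_pos (C : GCM ι) (i : ι) : ∃ q : ℚ, 0 < q ∧ sym C i = q :=
  ⟨_, C.symmetrizable.choose_spec.1 i, rfl⟩

theorem sym_ne_zero (C : GCM ι) (i : ι) : sym C i ≠ 0 := by
  obtain ⟨q, h, h'⟩ := sym_pos C i
  rw [h']; exact_mod_cast h.ne'

theorem sym_mul (C : GCM ι) (i j : ι) : sym C i * C.A i j = sym C j * C.A j i := by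
  have := C.symmetrizable.choose_spec.2 i j
  unfold sym
  exact_mod_cast congrArg (fun q : ℚ => (q : ℂ)) this

/-- Values on words of the invariant form. -/
noncomputable def formWord (C : GCM ι) : List ι → (Free ι →ₗ[ℂ] ℂ)
  | [] => 0
  | [i] => wlift (fun w => if w = [i] then (sym C i)⁻¹ else 0)
  | j :: k :: w => formWord C (k :: w) ∘ₗ contract C j

/-- The invariant form, transported to the free associative algebra. -/
noncomputable def form (C : GCM ι) : Free ι →ₗ[ℂ] Free ι →ₗ[ℂ] ℂ := wlift (formWord C)

theorem form_gen_gen (i j : ι) : form C (gen i) (gen j) = if i = j then (sym C i)⁻¹ else 0 := by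
  rw [← wd_singleton, ← wd_singleton, form, wlift_wd, formWord, wlift_wd]
  simp [eq_comm]

theorem form_gen_mul (j : ι) {n : ℕ} {m : Free ι} (hm : m ∈ height ι (n + 1)) (x : Free ι) :
    form C (gen j * m) x = form C m (contract C j x) := by
  refine eq_of_mem_wspan (f := (form C).flip x ∘ₗ LinearMap.mulLeft ℂ (gen j))
    (g := (form C).flip (contract C j x)) (fun w hw => ?_) hm
  match w, hw with
  | k :: w, _ => simp [← wd_cons, form, formWord]

theorem form_degree {w : List ι} {β : Multiset ι} (h : β ≠ w) {x : Free ι} (hx : x ∈ degree β) :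
    form C (wd w) x = 0 := by
  simp only [form, wlift_wd]
  induction w generalizing β x with
  | nil => simp [formWord]
  | cons j w ih =>
    match w with
    | [] =>
      refine eq_of_mem_wspan (f := formWord C [j]) (g := 0) (fun w hw => ?_) hx
      have : w ≠ [j] := by rintro rfl; exact h hw.symm
      simp [formWord, this]
    | k :: w =>
      rw [formWord, LinearMap.comp_apply]
      by_cases hj : j ∈ β
      · rw [← Multiset.cons_erase hj] at hx
        refine ih ?_ ((lowers_contract C j).mem hx)
        intro h'
        exact h (by rw [← Multiset.cons_erase hj, h', Multiset.cons_coe])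
      · rw [(lowers_contract C j).eq_zero hj hx, map_zero]

theorem form_aop (i : ι) (w : List ι) (x : Free ι) :
    form C (wd w) (aop C i x) = arow C i w * form C (wd w) x := by
  refine eq_of_mem_wspan (f := form C (wd w) ∘ₗ aop C i) (g := arow C i w • form C (wd w))
    (fun w' _ => ?_) (mem_wspan_true x)
  simp only [LinearMap.comp_apply, aop, wlift_wd, map_smul, LinearMap.smul_apply, smul_eq_mul]
  by_cases h : (w' : Multiset ι) = w
  · rw [arow_perm C i h]
  · rw [form_degree h (wd_mem_wspan rfl)]; simp

theorem form_adjoint (i : ι) {n : ℕ} {m x : Free ι} (hm : m ∈ height ι (n + 2))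
    (hx : x ∈ height ι (n + 1)) : form C m (gen i * x) = form C (contract C i m) x := by
  have key : ∀ w : List ι, 2 ≤ w.length → ∀ x ∈ height ι (w.length - 1),
      form C (wd w) (gen i * x) = form C (contract C i (wd w)) x := by
    refine word_induction (fun j k x hx => ?_) (fun j w hw ih x hx => ?_)
    · refine eq_of_mem_wspan (f := form C (wd [j, k]) ∘ₗ LinearMap.mulLeft ℂ (gen i))
        (g := form C (contract C i (wd [j, k]))) (fun w hw => ?_) hx
      obtain ⟨l, rfl⟩ := List.length_eq_one_iff.1 hw
      have h2 : wd [j, k] = gen j * gen k := by simp [wd]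
      rw [LinearMap.comp_apply, LinearMap.mulLeft_apply, wd_singleton, h2,
        form_gen_mul j (gen_mem_height k), contract_gen_mul_gen, contract_gen_mul_gen,
        map_sub, map_sub, LinearMap.sub_apply]
      congr 1
      · by_cases hij : i = j
        · subst hij
          by_cases hkl : k = l
          · subst hkl; simp
          · simp [form_gen_gen, hkl]
        · simp [hij, Ne.symm hij]
      · by_cases hjl : j = l <;> by_cases hik : i = k
        · subst hjl hik
          have := sym_mul C i j
          have h1 := sym_ne_zero C i
          have h2 := sym_ne_zero C j
          simp only [if_true, map_smul, LinearMap.smul_apply, form_gen_gen, smul_eq_mul]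
          field_simp
          linear_combination -this
        · subst hjl
          simp [form_gen_gen, hik, Ne.symm hik]
        · subst hik
          simp [form_gen_gen, hjl]
        · simp [hjl, hik]
    · obtain ⟨n, hn⟩ : ∃ n, w.length = n + 2 := ⟨w.length - 2, by omega⟩
      have hw' : wd w ∈ height ι (n + 2) := wd_mem_wspan hn
      have hx' : x ∈ height ι (n + 2) := by simpa [hn] using hx
      have hPx := (lowers_contract C j).height_mem hx'
      rw [wd_cons, form_gen_mul j (n := n + 1) hw', contract_gen_mul C j i hx',
        contract_gen_mul C i j hw', map_add, map_add, LinearMap.add_apply,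
        ih _ (by simpa [hn] using hPx),
        form_gen_mul j (n := n) ((lowers_contract C i).height_mem hw')]
      congr 1
      by_cases hij : i = j
      · subst hij
        rw [if_pos rfl, if_pos rfl, form_aop]
        simp [aop]
      · simp [hij, Ne.symm hij]
  refine eq_of_mem_wspan (f := (form C).flip (gen i * x))
    (g := (form C).flip x ∘ₗ contract C i) (fun w hw => ?_) hm
  exact key w (by omega) x (by simpa [hw] using hx)

theorem form_symm {n : ℕ} {x y : Free ι} (hx : x ∈ height ι n) (hy : y ∈ height ι n) :
    form C x y = form C y x := by
  have key : ∀ w : List ι, ∀ y ∈ height ι w.length, form C (wd w) y = form C y (wd w) := by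
    intro w
    induction w with
    | nil =>
      intro y hy
      refine eq_of_mem_wspan (f := form C (wd [])) (g := (form C).flip (wd []))
        (fun w hw => ?_) hy
      rw [List.length_eq_zero_iff.1 hw, LinearMap.flip_apply]
    | cons j w ih =>
      intro y hy
      rcases eq_or_ne w [] with rfl | hw
      · refine eq_of_mem_wspan (f := form C (wd [j])) (g := (form C).flip (wd [j]))
          (fun w hw => ?_) hy
        obtain ⟨k, rfl⟩ := List.length_eq_one_iff.1 hw
        rw [LinearMap.flip_apply, wd_singleton, wd_singleton, form_gen_gen, form_gen_gen]
        by_cases hjk : j = k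
        · subst hjk; rfl
        · simp [hjk, Ne.symm hjk]
      · obtain ⟨n, hn⟩ : ∃ n, w.length = n + 1 :=
          ⟨w.length - 1, by have := List.length_pos_iff.2 hw; omega⟩
        have hw' : wd w ∈ height ι (n + 1) := wd_mem_wspan hn
        have hy' : y ∈ height ι (n + 2) := by simpa [hn] using hy
        rw [wd_cons, form_gen_mul j hw', ih _ (by rw [hn]; exact (lowers_contract C j).height_mem hy'),
          form_adjoint j hy' hw']
  refine eq_of_mem_wspan (f := (form C).flip y) (g := form C y) (fun w hw => ?_) hx
  exact key w y (by rwa [hw])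

section DualFamilies

variable {V : Type*} [AddCommGroup V] [Module ℂ V]

/-- The radical of the restriction of a bilinear form to a subspace. -/
def radOn (B : V →ₗ[ℂ] V →ₗ[ℂ] ℂ) (U : Submodule ℂ V) : Submodule ℂ V where
  carrier := {x | x ∈ U ∧ ∀ m ∈ U, B m x = 0}
  add_mem' := fun ⟨ha, ha'⟩ ⟨hb, hb'⟩ =>
    ⟨add_mem ha hb, fun m hm => by rw [map_add, ha' m hm, hb' m hm, add_zero]⟩
  zero_mem' := ⟨zero_mem _, fun _ _ => map_zero _⟩
  smul_mem' := fun c _ ⟨ha, ha'⟩ =>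
    ⟨Submodule.smul_mem _ c ha, fun m hm => by rw [map_smul, ha' m hm, smul_zero]⟩

/-- Families in a subspace `U` which are dual to each other modulo the radical of a form. -/
structure DualFamily (B : V →ₗ[ℂ] V →ₗ[ℂ] ℂ) (U : Submodule ℂ V) where
  k : ℕ
  y : Fin k → V
  m : Fin k → V
  y_mem : ∀ s, y s ∈ U
  m_mem : ∀ s, m s ∈ U
  sub_mem : ∀ x ∈ U, x - ∑ s, B (m s) x • y s ∈ radOn B U
  sub_mem' : ∀ x ∈ U, x - ∑ s, B x (y s) • m s ∈ radOn B U

theorem exists_dualFamily (B : V →ₗ[ℂ] V →ₗ[ℂ] ℂ) (U : Submodule ℂ V) [FiniteDimensional ℂ U]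
    (hB : ∀ x ∈ U, ∀ y ∈ U, B x y = B y x) : Nonempty (DualFamily B U) := by
  let T : U →ₗ[ℂ] Module.Dual ℂ U := (Module.Dual.transpose U.subtype) ∘ₗ B ∘ₗ U.subtype
  have hT : ∀ a b : U, T a b = B a b := fun a b => rfl
  let b := Module.finBasis ℂ (LinearMap.range T)
  have hex : ∀ s, ∃ m : U, T m = b s := fun s => (b s).2
  choose m hm using hex
  have hex : ∀ s, ∃ g : Module.Dual ℂ (Module.Dual ℂ U),
      g ∘ₗ (LinearMap.range T).subtype = b.coord s := fun s =>
    LinearMap.exists_extend (b.coord s)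
  choose g hg using hex
  let y : Fin _ → U := fun s => (Module.evalEquiv ℂ U).symm (g s)
  have hy : ∀ s (φ : Module.Dual ℂ U), φ (y s) = g s φ := fun s φ => by
    rw [← Module.apply_evalEquiv_symm_apply]
  have hdual : ∀ a : U, T a = ∑ s, (T a (y s)) • T (m s) := by
    intro a
    have h1 := b.sum_repr ⟨T a, LinearMap.mem_range_self T a⟩
    have h2 := congrArg Subtype.val h1
    simp only [Submodule.coe_sum, Submodule.coe_smul] at h2
    conv_lhs => rw [← h2]
    refine Finset.sum_congr rfl fun s _ => ?_
    rw [hm, hy]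
    have := LinearMap.congr_fun (hg s) ⟨T a, LinearMap.mem_range_self T a⟩
    simp only [LinearMap.comp_apply, Submodule.subtype_apply, Module.Basis.coord_apply] at this
    rw [this]
  have hdual' : ∀ a c : U, B a c = ∑ s, B a (y s) * B (m s) c := by
    intro a c
    have := LinearMap.congr_fun (hdual a) c
    simpa [LinearMap.sum_apply, hT] using this
  refine ⟨⟨_, fun s => y s, fun s => m s, fun s => (y s).2, fun s => (m s).2, ?_, ?_⟩⟩
  · intro x hx
    refine ⟨Submodule.sub_mem _ hx (Submodule.sum_mem _ fun s _ =>
      Submodule.smul_mem _ _ (y s).2), fun a ha => ?_⟩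
    rw [map_sub, hdual' ⟨a, ha⟩ ⟨x, hx⟩, map_sum, sub_eq_zero]
    refine Finset.sum_congr rfl fun s _ => ?_
    rw [map_smul, smul_eq_mul, mul_comm]
  · intro x hx
    refine ⟨Submodule.sub_mem _ hx (Submodule.sum_mem _ fun s _ =>
      Submodule.smul_mem _ _ (m s).2), fun a ha => ?_⟩
    rw [map_sub, hB a ha x hx, hdual' ⟨x, hx⟩ ⟨a, ha⟩, map_sum, sub_eq_zero]
    refine Finset.sum_congr rfl fun s _ => ?_
    rw [map_smul, smul_eq_mul, hB a ha _ (m s).2]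

theorem DualFamily.exchange {B : V →ₗ[ℂ] V →ₗ[ℂ] ℂ} {U U' : Submodule ℂ V}
    (D : DualFamily B U) (D' : DualFamily B U') {M : Type*} [AddCommGroup M] [Module ℂ M]
    (Φ : V →ₗ[ℂ] V →ₗ[ℂ] M) (A A' : V →ₗ[ℂ] V)
    (hA : ∀ x ∈ U, A x ∈ U') (hA' : ∀ x ∈ U', A' x ∈ U)
    (adj : ∀ t ∈ U', ∀ x ∈ U, B t (A x) = B (A' t) x)
    (hl : ∀ r ∈ radOn B U', ∀ m ∈ U, Φ r m = 0) (hr : ∀ x ∈ U', ∀ r ∈ radOn B U, Φ x r = 0) :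
    ∑ s, Φ (A (D.y s)) (D.m s) = ∑ t, Φ (D'.y t) (A' (D'.m t)) := by
  have h1 : ∀ s, Φ (A (D.y s)) (D.m s) =
      ∑ t, B (A' (D'.m t)) (D.y s) • Φ (D'.y t) (D.m s) := by
    intro s
    have := hl _ (D'.sub_mem _ (hA _ (D.y_mem s))) _ (D.m_mem s)
    rw [map_sub, LinearMap.sub_apply, sub_eq_zero] at this
    rw [this, map_sum, LinearMap.sum_apply]
    refine Finset.sum_congr rfl fun t _ => ?_
    rw [map_smul, LinearMap.smul_apply, adj _ (D'.m_mem t) _ (D.y_mem s)]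
  rw [Finset.sum_congr rfl fun s _ => h1 s, Finset.sum_comm]
  refine Finset.sum_congr rfl fun t _ => ?_
  have := hr _ (D'.y_mem t) _ (D.sub_mem' _ (hA' _ (D'.m_mem t)))
  rw [map_sub, sub_eq_zero] at this
  rw [this, map_sum]
  exact Finset.sum_congr rfl fun s _ => (map_smul _ _ _).symm

end DualFamilies

attribute [local instance] LieRing.ofAssociativeRing

/-- Values on words of the raising operators of the Verma module. -/
noncomputable def eopWord (C : GCM ι) (l : ι → ℂ) (i : ι) : List ι → Free ι
  | [] => 0
  | j :: w => gen j * eopWord C l i w + if i = j then (l i - arow C i w) • wd w else 0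

/-- The raising operators of the Verma module of highest weight `l`. -/
noncomputable def eop (C : GCM ι) (l : ι → ℂ) (i : ι) : Free ι →ₗ[ℂ] Free ι :=
  wlift (eopWord C l i)

/-- The coroot operators of the Verma module of highest weight `l`. -/
noncomputable def hop (C : GCM ι) (l : ι → ℂ) (i : ι) : Free ι →ₗ[ℂ] Free ι :=
  wlift (fun w => (l i - arow C i w) • wd w)

/-- The lowering operators of the Verma modules. -/
noncomputable abbrev fop (i : ι) : Free ι →ₗ[ℂ] Free ι := LinearMap.mulLeft ℂ (gen i)

@[simp] theorem eop_one (l : ι → ℂ) (i : ι) : eop C l i 1 = 0 := by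
  rw [← wd_nil, eop, wlift_wd, eopWord]

theorem eop_gen_mul (l : ι → ℂ) (i j : ι) (x : Free ι) :
    eop C l i (gen j * x) = gen j * eop C l i x + if i = j then hop C l i x else 0 := by
  have : eop C l i ∘ₗ fop j = fop j ∘ₗ eop C l i + if i = j then hop C l i else 0 := by
    refine hom_ext fun w => ?_
    simp only [LinearMap.comp_apply, LinearMap.mulLeft_apply, ← wd_cons, eop, wlift_wd, eopWord,
      LinearMap.add_apply]
    split_ifs <;> simp [hop]
  have h := LinearMap.congr_fun this x
  simp only [LinearMap.comp_apply, LinearMap.mulLeft_apply, LinearMap.add_apply] at h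
  rw [h]
  split_ifs <;> rfl

theorem lowers_eop (l : ι → ℂ) (i : ι) : Lowers i (eop C l i) := by
  intro w
  simp only [eop, wlift_wd]
  induction w with
  | nil => simp [eopWord]
  | cons j w ih => exact lowers_step ih

theorem hop_of_mem_degree (l : ι → ℂ) (i : ι) {w : List ι} {x : Free ι}
    (hx : x ∈ degree (w : Multiset ι)) : hop C l i x = (l i - arow C i w) • x :=
  eq_of_mem_wspan (f := hop C l i) (g := (l i - arow C i w) • LinearMap.id)
    (fun w' hw' => by simp [hop, arow_perm C i hw']) hx

theorem lie_eop_fop (l : ι → ℂ) (i j : ι) :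
    ⁅eop C l i, (fop j : Module.End ℂ (Free ι))⁆ = if i = j then hop C l i else 0 := by
  refine LinearMap.ext fun x => ?_
  rw [Ring.lie_def, LinearMap.sub_apply, Module.End.mul_apply, Module.End.mul_apply,
    LinearMap.mulLeft_apply, LinearMap.mulLeft_apply, eop_gen_mul, add_sub_cancel_left]
  split_ifs <;> rfl

theorem lie_hop_eop (l : ι → ℂ) (i j : ι) :
    ⁅(hop C l i : Module.End ℂ (Free ι)), (eop C l j : Module.End ℂ (Free ι))⁆ =
      (C.A i j : ℂ) • eop C l j := by
  refine hom_ext fun w => ?_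
  rw [Ring.lie_def, LinearMap.sub_apply, Module.End.mul_apply, Module.End.mul_apply,
    hop_of_mem_degree l i (wd_mem_wspan (w := w) rfl), map_smul, LinearMap.smul_apply]
  by_cases hj : j ∈ w
  · have hw : ((j :: w.erase j : List ι) : Multiset ι) = w :=
      Multiset.coe_eq_coe.2 (List.perm_cons_erase hj).symm
    have := (lowers_eop (C := C) l j w).1 (w.erase j : List ι) hw
    rw [hop_of_mem_degree l i this, ← arow_perm C i hw, arow_cons, ← sub_smul]
    congr 1
    ring
  · simp [(lowers_eop (C := C) l j w).2 hj]

theorem lie_hop_fop (l : ι → ℂ) (i j : ι) :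
    ⁅(hop C l i : Module.End ℂ (Free ι)), (fop j : Module.End ℂ (Free ι))⁆ =
      (-C.A i j : ℂ) • fop j := by
  refine hom_ext fun w => ?_
  rw [Ring.lie_def, LinearMap.sub_apply, Module.End.mul_apply, Module.End.mul_apply,
    LinearMap.smul_apply, LinearMap.mulLeft_apply, LinearMap.mulLeft_apply, ← wd_cons]
  simp only [hop, wlift_wd, arow_cons, mul_smul_comm, ← wd_cons, ← sub_smul]
  congr 1
  ring

theorem map_nest {L L' : Type*} [LieRing L] [LieAlgebra ℂ L] [LieRing L'] [LieAlgebra ℂ L']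
    (φ : L →ₗ[ℂ] L') (hφ : ∀ a b, φ ⁅a, b⁆ = ⁅φ a, φ b⁆) (e : ι → L) (x : Free ι) :
    φ (nest e x) = nest (fun i => φ (e i)) x := by
  refine eq_of_mem_wspan (f := φ ∘ₗ nest e) (g := nest (fun i => φ (e i))) (fun w _ => ?_)
    (mem_wspan_true x)
  simp only [LinearMap.comp_apply, nest, wlift_wd]
  induction w with
  | nil => simp [br]
  | cons j w ih =>
    rcases eq_or_ne w [] with rfl | hw
    · simp [br]
    · rw [br_cons _ j hw, br_cons _ j hw, hφ, ih]

/-- Nested commutators of the generators of the free algebra. -/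
noncomputable abbrev Y : Free ι →ₗ[ℂ] Free ι := nest gen

theorem mulLeft_Y (x : Free ι) : LinearMap.mulLeft ℂ (Y x) =
    nest (L := Module.End ℂ (Free ι)) (fun i => (fop i : Module.End ℂ (Free ι))) x := by
  refine map_nest (LinearMap.mul ℂ (Free ι)) (L' := Module.End ℂ (Free ι)) (fun a b => ?_) gen x
  refine LinearMap.ext fun z => ?_
  simp [Ring.lie_def, mul_assoc]

theorem Y_gen_mul (i : ι) {n : ℕ} {x : Free ι} (hx : x ∈ height ι (n + 1)) :
    Y (gen i * x) = gen i * Y x - Y x * gen i := by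
  rw [nest_gen_mul gen i hx, Ring.lie_def]

theorem eop_Y_mul (l : ι → ℂ) (k : ι) {n : ℕ} {x : Free ι} (hx : x ∈ height ι (n + 2))
    (z : Free ι) : eop C l k (Y x * z) = Y x * eop C l k z - Y (contract C k x) * z := by
  have := nest_lie (C := C) (L := Module.End ℂ (Free ι))
    (e := fun i => (fop i : Module.End ℂ (Free ι)))
    (f := fun i => (eop C l i : Module.End ℂ (Free ι))) (h := fun i => -hop C l i)
    (fun i j => by
      rw [← lie_skew, lie_eop_fop]
      by_cases h : i = j
      · subst h; simp
      · simp [h, Ne.symm h])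
    (fun i j => by rw [neg_lie, lie_hop_fop, neg_smul, neg_neg]) k hx
  rw [← mulLeft_Y, ← mulLeft_Y] at this
  have h := LinearMap.congr_fun this z
  rw [Ring.lie_def, LinearMap.sub_apply, Module.End.mul_apply, Module.End.mul_apply] at h
  simp only [LinearMap.mulLeft_apply] at h
  rw [← h]
  abel

/-- Nested commutators of the raising operators. -/
noncomputable abbrev E (C : GCM ι) (l : ι → ℂ) : Free ι →ₗ[ℂ] Module.End ℂ (Free ι) :=
  nest (fun i => (eop C l i : Module.End ℂ (Free ι)))

theorem E_gen (l : ι → ℂ) (j : ι) : E C l (gen j) = eop C l j := nest_gen _ j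

theorem E_gen_mul (l : ι → ℂ) (i : ι) {n : ℕ} {m : Free ι} (hm : m ∈ height ι (n + 2))
    (x : Free ι) : E C l m (gen i * x) = gen i * E C l m x + E C l (contract C i m) x := by
  have := nest_lie (C := C) (L := Module.End ℂ (Free ι)) (lie_eop_fop l) (lie_hop_eop l) i hm
  have h := LinearMap.congr_fun this x
  rw [Ring.lie_def, LinearMap.sub_apply, Module.End.mul_apply, Module.End.mul_apply] at h
  simp only [LinearMap.mulLeft_apply] at h
  rw [← h]
  abel

theorem E_apply_mem {l : ι → ℂ} {J : Submodule ℂ (Free ι)} (hJ : ∀ i, ∀ x ∈ J, eop C l i x ∈ J)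
    {x : Free ι} (hx : ∀ i, eop C l i x ∈ J) (m : Free ι) : E C l m x ∈ J := by
  have key : ∀ w : List ι, (∀ z ∈ J, E C l (wd w) z ∈ J) ∧ E C l (wd w) x ∈ J := by
    intro w
    simp only [nest, wlift_wd]
    induction w with
    | nil => simp [br]
    | cons j w ih =>
      rcases eq_or_ne w [] with rfl | hw
      · exact ⟨hJ j, hx j⟩
      · rw [br_cons _ j hw, Ring.lie_def]
        exact ⟨fun z hz => J.sub_mem (hJ j _ (ih.1 z hz)) (ih.1 _ (hJ j z hz)),
          J.sub_mem (hJ j _ ih.2) (ih.1 _ (hx j))⟩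
  exact map_mem_of_wd (f := LinearMap.applyₗ x ∘ₗ E C l) (fun w => (key w).2) m

@[simp] theorem E_one (l : ι → ℂ) (m : Free ι) : E C l m 1 = 0 := by
  have := E_apply_mem (C := C) (l := l) (J := ⊥) (x := 1) (by simp) (by simp) m
  simpa using this

theorem E_of_lt (l : ι → ℂ) {n : ℕ} {m : Free ι} (hm : m ∈ height ι (n + 1)) {w : List ι}
    (hw : w.length ≤ n) : E C l m (wd w) = 0 := by
  induction w generalizing n m with
  | nil => simp
  | cons i w ih =>
    obtain ⟨n, rfl⟩ : ∃ n', n = n' + 1 := ⟨n - 1, by simp at hw; omega⟩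
    simp only [List.length_cons, Nat.add_le_add_iff_right] at hw
    rw [wd_cons, E_gen_mul l i hm, ih hm (by omega),
      ih ((lowers_contract C i).height_mem hm) hw, mul_zero, add_zero]

theorem mem_height_one {x : Free ι} (hx : x ∈ height ι 1) :
    x = ∑ i, (sym C i * form C (gen i) x) • gen i := by
  refine eq_of_mem_wspan (f := LinearMap.id)
    (g := ∑ i, ((sym C i • form C (gen i)).smulRight (gen i))) (fun w hw => ?_) hx |>.trans ?_
  · obtain ⟨j, rfl⟩ := List.length_eq_one_iff.1 hw
    rw [wd_singleton, LinearMap.sum_apply, Finset.sum_eq_single j]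
    · simp [form_gen_gen, sym_ne_zero]
    · intro i _ hij
      simp [form_gen_gen, hij]
    · simp
  · simp [LinearMap.sum_apply]

theorem E_zero_of_le {n : ℕ} {m : Free ι} (hm : m ∈ height ι (n + 1)) {w : List ι}
    (hw : w.length ≤ n + 1) : E C 0 m (wd w) = 0 := by
  induction w generalizing n m with
  | nil => simp
  | cons i w ih =>
    simp only [List.length_cons, Nat.add_le_add_iff_right] at hw
    match n with
    | 0 =>
      obtain rfl : w = [] := List.length_eq_zero_iff.1 (by omega)
      rw [mem_height_one (C := C) hm, map_sum, LinearMap.sum_apply]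
      refine Finset.sum_eq_zero fun j _ => ?_
      rw [map_smul, LinearMap.smul_apply, E_gen, wd_cons, eop_gen_mul]
      simp only [wd_nil, eop_one, mul_zero, zero_add]
      split_ifs
      · rw [← wd_nil, hop, wlift_wd]; simp
      · simp
    | n + 1 =>
      rw [wd_cons, E_gen_mul 0 i hm, ih hm (by omega),
        ih ((lowers_contract C i).height_mem hm) hw, mul_zero, add_zero]

/-- The radical of the invariant form in height `n`. -/
noncomputable abbrev rad (C : GCM ι) (n : ℕ) : Submodule ℂ (Free ι) := radOn (form C) (height ι n)

theorem rad_one {r : Free ι} (hr : r ∈ rad C 1) : r = 0 := by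
  rw [mem_height_one (C := C) hr.1]
  exact Finset.sum_eq_zero fun i _ => by rw [hr.2 _ (gen_mem_height i)]; simp

theorem contract_mem_rad (i : ι) {n : ℕ} {r : Free ι} (hr : r ∈ rad C (n + 2)) :
    contract C i r ∈ rad C (n + 1) :=
  ⟨(lowers_contract C i).height_mem hr.1, fun m hm => by
    rw [← form_gen_mul i hm]; exact hr.2 _ (gen_mul_mem_height i hm)⟩

theorem pr_mem_rad (β : Multiset ι) {n : ℕ} {r : Free ι} (hr : r ∈ rad C n) :
    pr β r ∈ rad C n := by
  constructor
  · refine map_mem_of_mem_wspan (fun w hw => ?_) hr.1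
    simp only [pr, wlift_wd]
    split_ifs
    · exact wd_mem_wspan hw
    · exact zero_mem _
  · intro m hm
    refine eq_of_mem_wspan (f := (form C).flip (pr β r)) (g := 0) (fun w hw => ?_) hm
    simp only [LinearMap.flip_apply, LinearMap.zero_apply]
    by_cases h : β = w
    · have : form C (wd w) (pr β r) = form C (wd w) r := by
        refine eq_of_mem_wspan (f := form C (wd w) ∘ₗ pr β) (g := form C (wd w)) (fun w' _ => ?_)
          (mem_wspan_true r)
        simp only [LinearMap.comp_apply, pr, wlift_wd]
        split_ifs with h'
        · rfl
        · rw [map_zero, form_degree (by rwa [h] at h') (wd_mem_wspan rfl)]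
      rw [this, hr.2 _ (wd_mem_wspan hw)]
    · exact form_degree h (pr_mem β r)

theorem E_rad (l : ι → ℂ) {n : ℕ} {r : Free ι} (hr : r ∈ rad C (n + 1)) : E C l r = 0 := by
  induction n generalizing r with
  | zero => rw [rad_one hr, map_zero]
  | succ n ih =>
    refine hom_ext fun w => ?_
    induction w with
    | nil => simp
    | cons i w ihw =>
      rw [wd_cons, E_gen_mul l i hr.1, ihw, ih (contract_mem_rad i hr)]
      simp

/-- A choice of dual families for the invariant form in height `n`. -/
noncomputable def dualFam (C : GCM ι) (n : ℕ) : DualFamily (form C) (height ι n) :=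
  (exists_dualFamily _ _ fun _ hx _ hy => form_symm hx hy).some

/-- The height `n` part of the Casimir operator. -/
noncomputable def casimirTerm (C : GCM ι) (l : ι → ℂ) (n : ℕ) : Free ι →ₗ[ℂ] Free ι :=
  ∑ s, LinearMap.mulLeft ℂ (Y ((dualFam C n).y s)) ∘ₗ E C l ((dualFam C n).m s)

theorem casimirTerm_apply (l : ι → ℂ) (n : ℕ) (x : Free ι) : casimirTerm C l n x =
    ∑ s, Y ((dualFam C n).y s) * E C l ((dualFam C n).m s) x := by
  simp [casimirTerm, LinearMap.sum_apply]

/-- The scalar by which the Casimir operator acts on the monomial of a word. -/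
noncomputable def casimirScalar (C : GCM ι) (l : ι → ℂ) : List ι → ℂ
  | [] => 0
  | i :: w => casimirScalar C l w + sym C i * (l i - arow C i w)

theorem two_mul_casimirScalar (l : ι → ℂ) (w : List ι) : 2 * casimirScalar C l w =
    (w.map fun k => sym C k * (2 * l k + 2 - arow C k w)).sum := by
  have h1 : ∀ (i : ι) (w : List ι), (w.map fun k => sym C k * (C.A k i : ℂ)).sum =
      sym C i * arow C i w := by
    intro i w
    induction w with
    | nil => simp
    | cons j w ih => simp [ih, mul_add, sym_mul C j i]
  induction w with
  | nil => simp [casimirScalar]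
  | cons i w ih =>
    have h2 : ∀ w' : List ι, (w'.map fun k => sym C k * (2 * l k + 2 - arow C k (i :: w))).sum =
        (w'.map fun k => sym C k * (2 * l k + 2 - arow C k w)).sum -
          (w'.map fun k => sym C k * (C.A k i : ℂ)).sum := by
      intro w'
      induction w' with
      | nil => simp
      | cons j w' ih' =>
        rw [List.map_cons, List.sum_cons, ih']
        simp only [List.map_cons, List.sum_cons, arow_cons]
        ring
    rw [List.map_cons, List.sum_cons, h2, h1, ← ih, casimirScalar, arow_cons, C.diag]
    push_cast
    ring

theorem casimirScalar_perm (l : ι → ℂ) {w w' : List ι}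
    (h : (w : Multiset ι) = (w' : Multiset ι)) : casimirScalar C l w = casimirScalar C l w' := by
  have : 2 * casimirScalar C l w = 2 * casimirScalar C l w' := by
    rw [two_mul_casimirScalar, two_mul_casimirScalar]
    simp only [arow_perm C _ h]
    exact ((Multiset.coe_eq_coe.1 h).map _).sum_eq
  simpa using this

theorem casimirScalar_ne_zero {l : ι → ℂ} {w : List ι} (hw : w ≠ [])
    (hl : ∀ i, ∃ n : ℕ, l i = n) (h : ∀ i, ∃ n : ℕ, l i - arow C i w = n) :
    casimirScalar C l w ≠ 0 := by
  intro h0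
  choose a ha using hl
  choose b hb using h
  choose q hq hq' using sym_pos C
  have h1 := two_mul_casimirScalar (C := C) l w
  have h2 : ∀ w' : List ι, (w'.map fun k => sym C k * (2 * l k + 2 - arow C k w)).sum =
      (((w'.map fun k => q k * (a k + 2 + b k)).sum : ℚ) : ℂ) := by
    intro w'
    induction w' with
    | nil => simp
    | cons k w' ih =>
      rw [List.map_cons, List.sum_cons, ih, List.map_cons, List.sum_cons, hq']
      have : 2 * l k + 2 - arow C k w = l k + 2 + (l k - arow C k w) := by ring
      rw [this, hb, ha]
      push_cast
      ring
  rw [h0, h2, mul_zero] at h1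
  have h3 : 0 < (w.map fun k => q k * ((a k : ℚ) + 2 + b k)).sum := by
    refine List.sum_pos _ ?_ (by simpa using hw)
    intro x hx
    obtain ⟨k, -, rfl⟩ := List.mem_map.1 hx
    have := hq k
    positivity
  exact h3.ne (by exact_mod_cast h1)

theorem sum_form_smul_y (i : ι) :
    ∑ s, form C ((dualFam C 1).m s) (gen i) • (dualFam C 1).y s = gen i := by
  have := rad_one ((dualFam C 1).sub_mem _ (gen_mem_height i))
  rw [sub_eq_zero] at this
  exact this.symm

theorem E_gen_mul_of_height_one (l : ι → ℂ) (i : ι) {m : Free ι} (hm : m ∈ height ι 1)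
    (x : Free ι) : E C l m (gen i * x) =
      gen i * E C l m x + (sym C i * form C m (gen i)) • hop C l i x := by
  refine eq_of_mem_wspan (f := LinearMap.applyₗ (gen i * x) ∘ₗ E C l)
    (g := fop i ∘ₗ LinearMap.applyₗ x ∘ₗ E C l +
      (sym C i • (form C).flip (gen i)).smulRight (hop C l i x)) (fun w hw => ?_) hm
  obtain ⟨j, rfl⟩ := List.length_eq_one_iff.1 hw
  simp only [LinearMap.comp_apply, LinearMap.applyₗ_apply_apply, LinearMap.add_apply,
    LinearMap.smulRight_apply, LinearMap.smul_apply, LinearMap.flip_apply, wd_singleton, E_gen,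
    eop_gen_mul, LinearMap.mulLeft_apply, form_gen_gen]
  congr 1
  by_cases h : j = i
  · subst h; simp [sym_ne_zero]
  · simp [h]

/-- The Casimir operator acts by a scalar on monomials, modulo a subspace containing the
defects. -/
theorem casimir (l : ι → ℂ) {J : Submodule ℂ (Free ι)} (hJ : ∀ i, ∀ x ∈ J, gen i * x ∈ J) (N : ℕ)
    (hdef : ∀ n, n + 1 < N → ∀ r ∈ rad C (n + 2), ∀ m ∈ height ι (n + 1), ∀ w : List ι,
      w.length < N → Y r * E C l m (wd w) ∈ J) (w : List ι) (hw : w.length ≤ N) :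
    ∑ n ∈ Finset.range N, casimirTerm C l (n + 1) (wd w) - casimirScalar C l w • wd w ∈ J := by
  induction w with
  | nil => simp [casimirTerm_apply, casimirScalar]
  | cons i w ih =>
    obtain ⟨N, rfl⟩ : ∃ N', N = N' + 1 := ⟨N - 1, by simp at hw; omega⟩
    simp only [List.length_cons, Nat.add_le_add_iff_right] at hw
    have ih := hJ i _ (ih (by omega))
    let D := fun n => dualFam C (n + 1)
    let G : ℕ → Free ι := fun n => ∑ s, Y ((D n).y s) *
      (E C l ((D n).m s) (gen i * wd w) - gen i * E C l ((D n).m s) (wd w))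
    let K : ℕ → Free ι := fun n => ∑ s, Y (gen i * (D n).y s) * E C l ((D n).m s) (wd w)
    have hstep : ∀ n, casimirTerm C l (n + 1) (gen i * wd w) =
        gen i * casimirTerm C l (n + 1) (wd w) + (G n - K n) := by
      intro n
      simp only [casimirTerm_apply, G, K, D, Finset.mul_sum]
      rw [← Finset.sum_sub_distrib, ← Finset.sum_add_distrib]
      refine Finset.sum_congr rfl fun s _ => ?_
      rw [Y_gen_mul i ((dualFam C (n + 1)).y_mem s)]
      noncomm_ring
    have hG0 : G 0 = sym C i • (gen i * hop C l i (wd w)) := by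
      simp only [G]
      have : ∀ s, Y ((D 0).y s) * (E C l ((D 0).m s) (gen i * wd w) -
          gen i * E C l ((D 0).m s) (wd w)) =
          sym C i • (Y (form C ((D 0).m s) (gen i) • (D 0).y s) * hop C l i (wd w)) := by
        intro s
        rw [E_gen_mul_of_height_one l i ((D 0).m_mem s), add_sub_cancel_left, map_smul,
          mul_smul_comm, smul_mul_assoc, smul_smul]
      rw [Finset.sum_congr rfl fun s _ => this s, ← Finset.smul_sum, ← Finset.sum_mul, ← map_sum]
      simp only [D]
      rw [sum_form_smul_y, nest_gen]
    have hKN : K N = 0 := Finset.sum_eq_zero fun s _ => by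
      rw [E_of_lt l ((D N).m_mem s) hw, mul_zero]
    have hKG : ∀ n, n < N → G (n + 1) - K n ∈ J := by
      intro n hn
      rw [← Submodule.Quotient.mk_eq_zero, Submodule.Quotient.mk_sub, sub_eq_zero]
      let Φ : Free ι →ₗ[ℂ] Free ι →ₗ[ℂ] (Free ι ⧸ J) :=
        ((LinearMap.mul ℂ (Free ι)).compl₁₂ Y (LinearMap.applyₗ (wd w) ∘ₗ E C l)).compr₂ J.mkQ
      have hΦ : ∀ x m, Φ x m = J.mkQ (Y x * E C l m (wd w)) := fun x m => rfl
      have := (D n).exchange (D (n + 1)) Φ (fop i) (contract C i)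
        (fun x hx => gen_mul_mem_height i hx) (fun x hx => (lowers_contract C i).height_mem hx)
        (fun t ht x hx => form_adjoint i ht hx)
        (fun r hr m hm => by
          rw [hΦ, Submodule.mkQ_apply, Submodule.Quotient.mk_eq_zero]
          exact hdef n (by omega) r hr m hm w (by omega))
        (fun x _ r hr => by rw [hΦ, E_rad l hr]; simp)
      simp only [hΦ, ← map_sum, LinearMap.mulLeft_apply] at this
      simp only [Submodule.mkQ_apply] at this
      refine Eq.trans ?_ this.symm
      congr 1
      refine Finset.sum_congr rfl fun s _ => ?_
      rw [E_gen_mul l i ((D (n + 1)).m_mem s), add_sub_cancel_left]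
    have hsum : ∑ n ∈ Finset.range (N + 1), (G n - K n) =
        G 0 + ∑ n ∈ Finset.range N, (G (n + 1) - K n) := by
      rw [Finset.sum_sub_distrib, Finset.sum_range_succ' G, Finset.sum_range_succ K, hKN,
        Finset.sum_sub_distrib]
      abel
    have hfin : ∑ n ∈ Finset.range N, (G (n + 1) - K n) ∈ J :=
      Submodule.sum_mem _ fun n hn => hKG n (Finset.mem_range.1 hn)
    have := J.add_mem ih hfin
    convert this using 1
    rw [wd_cons]
    simp only [hstep, Finset.sum_add_distrib]
    rw [hsum, hG0, hop, wlift_wd, casimirScalar, mul_sub (gen i), Finset.mul_sum, mul_smul_comm,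
      mul_smul_comm, smul_smul, add_smul]
    abel

/-- The Casimir scalar times an element killed by the raising operators modulo `J` lies in `J`. -/
theorem casimir_smul_mem {l : ι → ℂ} {J : Submodule ℂ (Free ι)}
    (hJ : ∀ i, ∀ x ∈ J, gen i * x ∈ J) (hJe : ∀ i, ∀ x ∈ J, eop C l i x ∈ J) {w : List ι}
    (hdef : ∀ n, n + 1 < w.length → ∀ r ∈ rad C (n + 2), ∀ m ∈ height ι (n + 1), ∀ w' : List ι,
      w'.length < w.length → Y r * E C l m (wd w') ∈ J)
    {x : Free ι} (hx : x ∈ degree (w : Multiset ι)) (hex : ∀ i, eop C l i x ∈ J) :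
    casimirScalar C l w • x ∈ J := by
  have hmul : ∀ a : Free ι, ∀ z ∈ J, a * z ∈ J := by
    intro a z hz
    refine map_mem_of_wd (f := LinearMap.mulRight ℂ z) (fun w => ?_) a
    rw [LinearMap.mulRight_apply]
    induction w with
    | nil => simpa using hz
    | cons i w ih => rw [wd_cons, mul_assoc]; exact hJ i _ ih
  have h1 : ∑ n ∈ Finset.range w.length, casimirTerm C l (n + 1) x - casimirScalar C l w • x ∈ J := by
    have := map_mem_of_mem_wspan (f := ∑ n ∈ Finset.range w.length, casimirTerm C l (n + 1) -
      casimirScalar C l w • LinearMap.id) (N := J) (fun w' hw' => ?_) hx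
    · simpa [LinearMap.sum_apply] using this
    · have hlen : w'.length = w.length := (Multiset.coe_eq_coe.1 hw').length_eq
      have := casimir l hJ w.length hdef w' hlen.le
      simpa [LinearMap.sum_apply, casimirScalar_perm l hw'] using this
  have h2 : ∑ n ∈ Finset.range w.length, casimirTerm C l (n + 1) x ∈ J :=
    Submodule.sum_mem _ fun n _ => by
      rw [casimirTerm_apply]
      exact Submodule.sum_mem _ fun s _ => hmul _ _ (E_apply_mem hJe hex _)
  simpa using J.sub_mem h2 h1

theorem exists_nat_of_chain {V : Type*} [AddCommGroup V] [Module ℂ V] {J : Submodule ℂ V}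
    {x : ℕ → V} {c : ℂ} (h0 : x 0 ∉ J) (hk : ∃ k, x k ∈ J)
    (hs : ∀ k, x (k + 1) ∈ J → (((k : ℂ) + 1) * (c - k)) • x k ∈ J) : ∃ n : ℕ, c = n := by
  classical
  obtain ⟨k, hk'⟩ : ∃ k, k + 1 = Nat.find hk := by
    refine ⟨Nat.find hk - 1, Nat.sub_add_cancel (Nat.one_le_iff_ne_zero.2 fun h => h0 ?_)⟩
    have := Nat.find_spec hk
    rwa [h] at this
  have h1 := hs k (by rw [hk']; exact Nat.find_spec hk)
  have h2 : x k ∉ J := Nat.find_min hk (by omega)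
  have h3 : ((k : ℂ) + 1) * (c - k) = 0 := by
    by_contra h
    exact h2 ((Submodule.smul_mem_iff _ h).1 h1)
  rcases mul_eq_zero.1 h3 with h | h
  · exact absurd h (by exact_mod_cast k.succ_ne_zero)
  · exact ⟨k, sub_eq_zero.1 h⟩

/-- Local nilpotency modulo subspaces propagates through bilinear maps satisfying the Leibniz
rule. -/
theorem leibniz_pow_mem {P Q M : Type*} [AddCommGroup P] [Module ℂ P] [AddCommGroup Q]
    [Module ℂ Q] [AddCommGroup M] [Module ℂ M] (μ : P →ₗ[ℂ] Q →ₗ[ℂ] M)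
    {D₁ : Module.End ℂ P} {D₂ : Module.End ℂ Q} {D₃ : Module.End ℂ M}
    (hD : ∀ a b, D₃ (μ a b) = μ (D₁ a) b + μ a (D₂ b)) {S₁ : Submodule ℂ P} {S₂ : Submodule ℂ Q}
    {S₃ : Submodule ℂ M} (h₁ : ∀ a ∈ S₁, ∀ b, μ a b ∈ S₃) (h₂ : ∀ a, ∀ b ∈ S₂, μ a b ∈ S₃)
    (h₃ : ∀ z ∈ S₃, D₃ z ∈ S₃) (p q : ℕ) (a : P) (b : Q) (ha : (D₁ ^ p) a ∈ S₁)
    (hb : (D₂ ^ q) b ∈ S₂) : (D₃ ^ (p + q)) (μ a b) ∈ S₃ := by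
  have hst : ∀ n, ∀ z ∈ S₃, (D₃ ^ n) z ∈ S₃ := by
    intro n
    induction n with
    | zero => intro z hz; simpa using hz
    | succ n ih => intro z hz; rw [pow_succ]; exact ih _ (h₃ z hz)
  induction hn : p + q generalizing p q a b with
  | zero =>
    obtain ⟨rfl, rfl⟩ := Nat.add_eq_zero_iff.1 hn
    exact hst 0 _ (h₁ _ ha _)
  | succ n ih =>
    match p, q with
    | 0, q => exact hst _ _ (h₁ _ ha _)
    | p, 0 => exact hst _ _ (h₂ _ _ hb)
    | p + 1, q + 1 =>
      rw [pow_succ, Module.End.mul_apply, hD, map_add]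
      exact S₃.add_mem (ih p (q + 1) _ _ (by rwa [pow_succ] at ha) hb (by omega))
        (ih (p + 1) q _ _ ha (by rwa [pow_succ] at hb) (by omega))

theorem sl2_apply_pow {V : Type*} [AddCommGroup V] [Module ℂ V] {e f h : Module.End ℂ V}
    (hef : ∀ x, e (f x) = f (e x) + h x) (hhf : ∀ x, h (f x) = f (h x) - (2 : ℂ) • f x) {x : V}
    {c : ℂ} (hx : h x = c • x) (k : ℕ) :
    e ((f ^ (k + 1)) x) = (f ^ (k + 1)) (e x) + (((k : ℂ) + 1) * (c - k)) • (f ^ k) x := by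
  have h1 : ∀ k : ℕ, h ((f ^ k) x) = (c - 2 * k) • (f ^ k) x := by
    intro k
    induction k with
    | zero => simp [hx]
    | succ k ih =>
      rw [pow_succ', Module.End.mul_apply, hhf, ih, map_smul, ← sub_smul]
      congr 1
      push_cast
      ring
  induction k with
  | zero => simp [hef, hx]
  | succ k ih =>
    rw [pow_succ', Module.End.mul_apply, hef, ih, h1, map_add, map_smul,
      ← Module.End.mul_apply f, ← Module.End.mul_apply f, ← pow_succ', ← pow_succ', add_assoc,
      ← add_smul]
    congr 2
    push_cast
    ring

theorem fop_pow_apply (i : ι) (k : ℕ) (x : Free ι) :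
    ((fop i : Module.End ℂ (Free ι)) ^ k) x = gen i ^ k * x := by
  rw [LinearMap.pow_mulLeft, LinearMap.mulLeft_apply]

theorem hop_gen_mul (l : ι → ℂ) (i : ι) (x : Free ι) :
    hop C l i (gen i * x) = gen i * hop C l i x - (2 : ℂ) • (gen i * x) := by
  have := LinearMap.congr_fun (lie_hop_fop (C := C) l i i) x
  rw [Ring.lie_def, LinearMap.sub_apply, Module.End.mul_apply, Module.End.mul_apply, C.diag] at this
  simp only [LinearMap.mulLeft_apply, LinearMap.smul_apply, Int.cast_ofNat] at this
  rw [sub_eq_iff_eq_add] at this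
  rw [this, neg_smul]
  abel

theorem eop_pow_mul (l : ι → ℂ) (i : ι) {c : ℂ} {x : Free ι} (hx : hop C l i x = c • x) (k : ℕ) :
    eop C l i (gen i ^ (k + 1) * x) =
      gen i ^ (k + 1) * eop C l i x + (((k : ℂ) + 1) * (c - k)) • (gen i ^ k * x) := by
  have := sl2_apply_pow (e := eop C l i) (f := fop i) (h := hop C l i)
    (fun x => by simp [eop_gen_mul]) (fun x => by simp [hop_gen_mul]) hx k
  simpa only [fop_pow_apply] using this

theorem mul_mem_degree {β γ : Multiset ι} {x y : Free ι} (hx : x ∈ degree β)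
    (hy : y ∈ degree γ) : x * y ∈ degree (β + γ) := by
  refine map_mem_of_mem_wspan (f := LinearMap.mulRight ℂ y) (fun w hw => ?_) hx
  refine map_mem_of_mem_wspan (f := LinearMap.mulLeft ℂ (wd w)) (fun w' hw' => ?_) hy
  rw [LinearMap.mulLeft_apply, ← wd_append]
  exact wd_mem_wspan (by rw [← hw, ← hw', Multiset.coe_add])

theorem gen_mem_degree (i : ι) : gen i ∈ degree ({i} : Multiset ι) := by
  rw [← wd_singleton]; exact wd_mem_wspan rfl

theorem gen_pow_mem_degree (i : ι) (n : ℕ) : gen i ^ n ∈ degree (Multiset.replicate n i) := by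
  induction n with
  | zero => rw [pow_zero, ← wd_nil]; exact wd_mem_wspan rfl
  | succ n ih => rw [pow_succ', Multiset.replicate_succ]; exact gen_mul_mem_degree i ih

theorem Y_mem_degree {β : Multiset ι} {x : Free ι} (hx : x ∈ degree β) : Y x ∈ degree β := by
  have key : ∀ w : List ι, br gen w ∈ degree (w : Multiset ι) := by
    intro w
    induction w with
    | nil => exact zero_mem _
    | cons j w ih =>
      rcases eq_or_ne w [] with rfl | hw
      · exact gen_mem_degree j
      · rw [br_cons _ j hw, Ring.lie_def, ← Multiset.cons_coe]
        exact sub_mem (gen_mul_mem_degree j ih) (mul_gen_mem_degree j ih)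
  refine map_mem_of_mem_wspan (fun w hw => ?_) hx
  simp only [nest, wlift_wd, ← hw]
  exact key w

/-- The commutator with a generator. -/
noncomputable def adg (i : ι) : Module.End ℂ (Free ι) :=
  LinearMap.mulLeft ℂ (gen i) - LinearMap.mulRight ℂ (gen i)

theorem adg_apply (i : ι) (x : Free ι) : adg i x = gen i * x - x * gen i := rfl

theorem gen_pow_mul_mem_height (i : ι) {n : ℕ} {x : Free ι} (hx : x ∈ height ι n) (k : ℕ) :
    gen i ^ k * x ∈ height ι (n + k) := by
  induction k with
  | zero => simpa using hx
  | succ k ih => rw [pow_succ', mul_assoc]; exact gen_mul_mem_height i ih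

theorem Y_pow_mul (i : ι) {n : ℕ} {x : Free ι} (hx : x ∈ height ι (n + 1)) (k : ℕ) :
    Y (gen i ^ k * x) = (adg i ^ k) (Y x) := by
  induction k with
  | zero => simp
  | succ k ih =>
    have h := gen_pow_mul_mem_height i hx k
    rw [show n + 1 + k = n + k + 1 by omega] at h
    rw [pow_succ', mul_assoc, Y_gen_mul i h, ih, pow_succ', Module.End.mul_apply, adg_apply]

theorem contract_pow_mul_gen {i j : ι} (hij : i ≠ j) (k : ι) (n : ℕ) :
    contract C k (gen i ^ (n + 1) * gen j) =
      (if k = i then (((n : ℂ) + 1) * (n + C.A i j)) • (gen i ^ n * gen j) else 0) -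
        if k = j then (C.A j i : ℂ) • gen i ^ (n + 1) else 0 := by
  induction n with
  | zero =>
    rw [zero_add, pow_one, contract_gen_mul_gen]
    congr 1
    · by_cases h : k = i
      · subst h; simp
      · simp [h]
    · by_cases h : k = j
      · subst h; simp
      · simp [h]
  | succ n ih =>
    have hh := gen_pow_mul_mem_height i (gen_mem_height j) (n + 1)
    have hd : gen i ^ (n + 1) * gen j ∈ degree ((List.replicate (n + 1) i ++ [j] : List ι) :
        Multiset ι) := by
      rw [← Multiset.coe_add]
      exact mul_mem_degree (gen_pow_mem_degree i (n + 1)) (gen_mem_degree j)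
    rw [show 1 + (n + 1) = n + 2 by omega] at hh
    rw [pow_succ' _ (n + 1), mul_assoc, contract_gen_mul C k i hh, ih]
    by_cases h : k = i
    · subst h
      have : aop C k (gen k ^ (n + 1) * gen j) =
          (2 * ((n : ℂ) + 1) + C.A k j) • (gen k ^ (n + 1) * gen j) := by
        refine eq_of_mem_wspan (f := aop C k)
          (g := (2 * ((n : ℂ) + 1) + C.A k j) • LinearMap.id) (fun w hw => ?_) hd
        rw [aop, wlift_wd, arow_perm C k hw]
        simp only [arow, List.map_append, List.map_replicate, List.sum_append, List.sum_replicate,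
          C.diag, List.map_cons, List.map_nil, List.sum_cons, List.sum_nil, nsmul_eq_mul,
          LinearMap.smul_apply, LinearMap.id_apply]
        congr 1
        push_cast
        ring
      simp only [if_true, if_neg hij, sub_zero, this]
      rw [mul_smul_comm, ← mul_assoc, ← pow_succ', ← add_smul]
      congr 1
      push_cast
      ring
    · simp only [if_neg h, zero_sub, add_zero, mul_neg]
      split_ifs
      · rw [mul_smul_comm, ← pow_succ']
      · simp

/-- The Serre elements. -/
noncomputable def serre (C : GCM ι) (i j : ι) : Free ι :=
  Y (gen i ^ (1 - C.A i j).toNat * gen j)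

theorem exists_toNat {i j : ι} (hij : i ≠ j) :
    ∃ n : ℕ, (1 - C.A i j).toNat = n + 1 ∧ (C.A i j : ℂ) = -n := by
  have := C.offdiag i j hij
  refine ⟨(-C.A i j).toNat, by omega, ?_⟩
  have h : ((-C.A i j).toNat : ℤ) = -C.A i j := Int.toNat_of_nonneg (by omega)
  have h' : (((-C.A i j).toNat : ℤ) : ℂ) = -C.A i j := by rw [h]; push_cast; rfl
  rw [Int.cast_natCast] at h'
  rw [h']; ring

theorem Y_pow_eq_zero (i : ι) (n : ℕ) : Y (gen i ^ (n + 2)) = 0 := by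
  rw [pow_succ, Y_pow_mul i (n := 0) (gen_mem_height i), pow_succ, Module.End.mul_apply, adg_apply,
    nest_gen, sub_self, map_zero]

theorem eop_serre_mul (l : ι → ℂ) {i j : ι} (hij : i ≠ j) (k : ι) (z : Free ι) :
    eop C l k (serre C i j * z) = serre C i j * eop C l k z := by
  obtain ⟨n, hn, hA⟩ := exists_toNat (C := C) hij
  have hh := gen_pow_mul_mem_height i (gen_mem_height j) (n + 1)
  rw [show 1 + (n + 1) = n + 2 by omega] at hh
  rw [serre, hn, eop_Y_mul l k hh, contract_pow_mul_gen hij, hA]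
  have h1 : (if k = j then (C.A j i : ℂ) • Y (gen i ^ (n + 1)) else 0) = 0 := by
    split_ifs
    · match n, hA with
      | 0, hA =>
        have h0 : C.A i j = 0 := by
          have : (C.A i j : ℂ) = 0 := by simpa using hA
          exact_mod_cast this
        rw [C.zero_iff i j h0]; simp
      | n + 1, _ => rw [Y_pow_eq_zero, smul_zero]
    · rfl
  have h2 : Y (if k = j then (C.A j i : ℂ) • gen i ^ (n + 1) else 0) = 0 := by
    rw [← h1]; split_ifs <;> simp
  rw [map_sub, h2]
  simp

theorem serre_mem_degree (i j : ι) :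
    serre C i j ∈ degree (Multiset.replicate (1 - C.A i j).toNat i + {j}) :=
  Y_mem_degree (mul_mem_degree (gen_pow_mem_degree _ _) (gen_mem_degree _))

theorem adg_pow_gen {i j : ι} : (adg i ^ (1 - C.A i j).toNat) (gen j) = serre C i j := by
  rw [serre, Y_pow_mul i (n := 0) (gen_mem_height j), nest_gen]

/-- The left ideal generated by a set. -/
noncomputable def leftSpan (Z : Set (Free ι)) : Submodule ℂ (Free ι) :=
  Submodule.span ℂ {x | ∃ w, ∃ z ∈ Z, x = wd w * z}

theorem leftSpan_mono {Z Z' : Set (Free ι)} (h : Z ⊆ Z') : leftSpan Z ≤ leftSpan Z' :=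
  Submodule.span_mono fun _ ⟨w, z, hz, hx⟩ => ⟨w, z, h hz, hx⟩

theorem subset_leftSpan {Z : Set (Free ι)} {z : Free ι} (hz : z ∈ Z) : z ∈ leftSpan Z :=
  Submodule.subset_span ⟨[], z, hz, by simp⟩

theorem map_leftSpan {Z : Set (Free ι)} {N : Submodule ℂ (Free ι)} {f : Free ι →ₗ[ℂ] Free ι}
    (h : ∀ w, ∀ z ∈ Z, f (wd w * z) ∈ N) {x : Free ι} (hx : x ∈ leftSpan Z) : f x ∈ N := by
  have : leftSpan Z ≤ N.comap f := by
    rw [leftSpan, Submodule.span_le]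
    rintro _ ⟨w, z, hz, rfl⟩
    exact h w z hz
  exact this hx

theorem gen_mul_mem_leftSpan {Z : Set (Free ι)} (i : ι) {x : Free ι} (hx : x ∈ leftSpan Z) :
    gen i * x ∈ leftSpan Z :=
  map_leftSpan (f := fop i) (fun w z hz => by
    rw [LinearMap.mulLeft_apply, ← mul_assoc, ← wd_cons]
    exact Submodule.subset_span ⟨_, z, hz, rfl⟩) hx

theorem mul_mem_leftSpan {Z : Set (Free ι)} (a : Free ι) {x : Free ι} (hx : x ∈ leftSpan Z) :
    a * x ∈ leftSpan Z := by
  refine map_mem_of_wd (f := LinearMap.mulRight ℂ x) (fun w => ?_) a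
  rw [LinearMap.mulRight_apply]
  induction w with
  | nil => simpa using hx
  | cons i w ih => rw [wd_cons, mul_assoc]; exact gen_mul_mem_leftSpan i ih

theorem pr_mem_leftSpan {Z : Set (Free ι)} (hZ : ∀ z ∈ Z, ∃ γ, z ∈ degree γ) (β : Multiset ι)
    {x : Free ι} (hx : x ∈ leftSpan Z) : pr β x ∈ leftSpan Z := by
  refine map_leftSpan (fun w z hz => ?_) hx
  obtain ⟨γ, hγ⟩ := hZ z hz
  have := mul_mem_degree (wd_mem_wspan (P := fun w' : List ι => (w' : Multiset ι) = w) rfl) hγ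
  by_cases h : (w : Multiset ι) + γ = β
  · subst h
    rw [pr_of_mem this]
    exact Submodule.subset_span ⟨w, z, hz, rfl⟩
  · rw [pr_of_mem_ne h this]; exact zero_mem _

theorem eop_mem_leftSpan {l : ι → ℂ} {Z : Set (Free ι)} (hZ : ∀ z ∈ Z, ∃ γ, z ∈ degree γ)
    (k : ι) (he : ∀ z ∈ Z, eop C l k z ∈ leftSpan Z) {x : Free ι} (hx : x ∈ leftSpan Z) :
    eop C l k x ∈ leftSpan Z := by
  refine map_leftSpan (fun w z hz => ?_) hx
  induction w with
  | nil => simpa using he z hz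
  | cons i w ih =>
    rw [wd_cons, mul_assoc, eop_gen_mul]
    refine add_mem (gen_mul_mem_leftSpan i ih) ?_
    split_ifs
    · obtain ⟨γ, hγ⟩ := hZ z hz
      obtain ⟨v, rfl⟩ := Quot.exists_rep γ
      have := mul_mem_degree (wd_mem_wspan (P := fun w' : List ι => (w' : Multiset ι) = w) rfl) hγ
      rw [hop_of_mem_degree l k (w := w ++ v) (by rwa [← Multiset.coe_add])]
      exact Submodule.smul_mem _ _ (Submodule.subset_span ⟨w, z, hz, rfl⟩)
    · exact zero_mem _

/-- Generators, as a left ideal, of the two-sided ideal generated by the Serre elements. -/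
def serreSet (C : GCM ι) : Set (Free ι) := {x | ∃ i j w, i ≠ j ∧ x = serre C i j * wd w}

/-- The two-sided ideal generated by the Serre elements. -/
noncomputable def serreIdeal (C : GCM ι) : Submodule ℂ (Free ι) := leftSpan (serreSet C)

theorem serreSet_homogeneous : ∀ z ∈ serreSet C, ∃ γ, γ ≠ 0 ∧ z ∈ degree γ := by
  rintro _ ⟨i, j, w, -, rfl⟩
  refine ⟨_, ?_, mul_mem_degree (serre_mem_degree i j) (wd_mem_wspan rfl)⟩
  simp

theorem serreSet_eop (l : ι → ℂ) (k : ι) : ∀ z ∈ serreSet C, eop C l k z ∈ serreIdeal C := by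
  rintro _ ⟨i, j, w, hij, rfl⟩
  rw [eop_serre_mul l hij]
  exact map_mem_of_wd (f := LinearMap.mulLeft ℂ (serre C i j))
    (fun w => subset_leftSpan (Z := serreSet C) ⟨i, j, w, hij, rfl⟩) _

theorem eop_mem_serreIdeal (l : ι → ℂ) (k : ι) {x : Free ι} (hx : x ∈ serreIdeal C) :
    eop C l k x ∈ serreIdeal C :=
  eop_mem_leftSpan (fun z hz => (serreSet_homogeneous z hz).imp fun _ h => h.2) k
    (serreSet_eop l k) hx

theorem mem_serreIdeal_mul {x : Free ι} (hx : x ∈ serreIdeal C) (a : Free ι) :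
    x * a ∈ serreIdeal C := by
  refine map_mem_of_wd (f := LinearMap.mulLeft ℂ x) (fun v => ?_) a
  refine map_leftSpan (f := LinearMap.mulRight ℂ (wd v)) (fun w z hz => ?_) hx
  obtain ⟨i, j, u, hij, rfl⟩ := hz
  rw [LinearMap.mulRight_apply, mul_assoc, mul_assoc, ← wd_append]
  exact Submodule.subset_span ⟨w, _, ⟨i, j, _, hij, rfl⟩, rfl⟩

theorem adg_mem_serreIdeal (i : ι) : ∀ x ∈ serreIdeal C, adg i x ∈ serreIdeal C := fun _ hx =>
  sub_mem (gen_mul_mem_leftSpan i hx) (mem_serreIdeal_mul hx _)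

theorem pow_mem_of_stable {V : Type*} [AddCommGroup V] [Module ℂ V] {D : Module.End ℂ V}
    {S : Submodule ℂ V} (hS : ∀ x ∈ S, D x ∈ S) (n : ℕ) {x : V} (hx : x ∈ S) : (D ^ n) x ∈ S := by
  induction n with
  | zero => simpa using hx
  | succ n ih => rw [pow_succ']; exact hS _ ih

/-- The subspace of vectors on which an operator is nilpotent modulo a stable subspace. -/
def nilSub {V : Type*} [AddCommGroup V] [Module ℂ V] (D : Module.End ℂ V)
    (S : Submodule ℂ V) (hS : ∀ x ∈ S, D x ∈ S) : Submodule ℂ V where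
  carrier := {x | ∃ k, (D ^ k) x ∈ S}
  zero_mem' := ⟨0, by simp⟩
  add_mem' := by
    rintro a b ⟨p, hp⟩ ⟨q, hq⟩
    refine ⟨p + q, ?_⟩
    rw [map_add]
    refine S.add_mem ?_ ?_
    · rw [add_comm, pow_add]; exact pow_mem_of_stable hS q hp
    · rw [pow_add]; exact pow_mem_of_stable hS p hq
  smul_mem' := by
    rintro c a ⟨p, hp⟩
    exact ⟨p, by rw [map_smul]; exact S.smul_mem c hp⟩

theorem adg_nilpotent (C : GCM ι) (i : ι) (x : Free ι) : ∃ k, (adg i ^ k) x ∈ serreIdeal C := by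
  refine map_mem_of_wd (f := LinearMap.id) (N := nilSub (adg i) _ (adg_mem_serreIdeal (C := C) i))
    (fun w => ?_) x
  rw [LinearMap.id_apply]
  induction w with
  | nil => exact ⟨1, by simp [adg_apply]⟩
  | cons j w ih =>
    obtain ⟨q, hq⟩ := ih
    have : ∃ p, (adg i ^ p) (gen j) ∈ serreIdeal C := by
      by_cases hij : i = j
      · subst hij; exact ⟨1, by simp [adg_apply]⟩
      · exact ⟨_, by rw [adg_pow_gen (C := C)]; exact subset_leftSpan ⟨i, j, [], hij, by simp⟩⟩
    obtain ⟨p, hp⟩ := this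
    refine ⟨p + q, ?_⟩
    rw [wd_cons]
    exact leibniz_pow_mem (LinearMap.mul ℂ (Free ι)) (D₁ := adg i) (D₂ := adg i) (D₃ := adg i)
      (fun a b => by simp only [LinearMap.mul_apply', adg_apply]; noncomm_ring)
      (fun a ha b => mem_serreIdeal_mul ha b) (fun a b hb => mul_mem_leftSpan a hb)
      (adg_mem_serreIdeal i) p q _ _ hp hq

theorem aop_of_mem_degree (i : ι) {w : List ι} {x : Free ι}
    (hx : x ∈ degree (w : Multiset ι)) : aop C i x = arow C i w • x :=
  eq_of_mem_wspan (f := aop C i) (g := arow C i w • LinearMap.id)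
    (fun w' hw' => by simp [aop, arow_perm C i hw']) hx

theorem contract_pow_mul (i : ι) {n : ℕ} {w : List ι} {y : Free ι} (hy : y ∈ height ι (n + 2))
    (hyw : y ∈ degree (w : Multiset ι)) (k : ℕ) : contract C i (gen i ^ (k + 1) * y) =
      gen i ^ (k + 1) * contract C i y +
        (((k : ℂ) + 1) * (arow C i w + k)) • (gen i ^ k * y) := by
  have haop : ∀ k : ℕ, aop C i (gen i ^ k * y) = (arow C i w + 2 * k) • (gen i ^ k * y) := by
    intro k
    have hd := mul_mem_degree (gen_pow_mem_degree i k) hyw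
    rw [← Multiset.coe_replicate, Multiset.coe_add] at hd
    rw [aop_of_mem_degree i hd]
    congr 1
    simp [arow, C.diag]
    ring
  have hh : ∀ k : ℕ, gen i ^ k * y ∈ height ι (n + k + 2) := by
    intro k
    convert gen_pow_mul_mem_height i hy k using 2
    omega
  induction k with
  | zero => rw [zero_add, pow_one, contract_gen_mul C i i hy]; simpa using haop 0
  | succ k ih =>
    rw [pow_succ' _ (k + 1), mul_assoc, contract_gen_mul C i i (hh (k + 1)), ih, if_pos rfl, haop,
      mul_add, mul_smul_comm, ← mul_assoc, ← mul_assoc, ← pow_succ', ← pow_succ', add_assoc,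
      ← add_smul]
    congr 2
    push_cast
    ring

theorem height_disjoint {n : ℕ} {β : Multiset ι} (h : β.card ≠ n) {x : Free ι}
    (hx : x ∈ height ι n) : pr β x = 0 :=
  eq_of_mem_wspan (f := pr β) (g := 0) (fun w hw => by
    have : (w : Multiset ι) ≠ β := by
      rintro rfl
      exact h (by simpa using hw)
    simp [pr, this]) hx

/-- Nested commutators of elements of the radical of the invariant form lie in the ideal
generated by the Serre elements. -/
theorem Y_rad {n : ℕ} {r : Free ι} (hr : r ∈ rad C (n + 1)) : Y r ∈ serreIdeal C := by
  induction n using Nat.strong_induction_on generalizing r with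
  | _ n ih =>
  match n with
  | 0 => rw [rad_one hr, map_zero]; exact zero_mem _
  | n + 1 =>
  refine mem_of_pr (N := (serreIdeal C).comap Y) (x := r) fun β => ?_
  rw [Submodule.mem_comap]
  by_cases hc : β.card = n + 2
  swap
  · rw [height_disjoint hc hr.1, map_zero]; exact zero_mem _
  have hyr := pr_mem_rad β hr
  have hyd := pr_mem β r
  set y := pr β r
  obtain ⟨w, rfl⟩ := Quot.exists_rep β
  replace hc : w.length = n + 2 := hc
  replace hyd : y ∈ degree (w : Multiset ι) := hyd
  by_contra hy
  have hP : ∀ i, Y (contract C i y) ∈ serreIdeal C := fun i =>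
    ih n (by omega) (contract_mem_rad i hyr)
  have hchain : ∀ i, ∃ a : ℕ, (0 : ι → ℂ) i - arow C i w = a := by
    intro i
    refine exists_nat_of_chain (J := serreIdeal C) (x := fun k => (adg i ^ k) (Y y))
      (by simpa using hy) (adg_nilpotent C i _) fun k hk => ?_
    have h1 := eop_mem_serreIdeal 0 i hk
    have hh : gen i ^ (k + 1) * y ∈ height ι (n + k + 1 + 2) := by
      convert gen_pow_mul_mem_height i hyr.1 (k + 1) using 2
      omega
    rw [← Y_pow_mul i hyr.1, ← mul_one (Y _), eop_Y_mul 0 i hh, eop_one, mul_zero, mul_one,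
      zero_sub, contract_pow_mul i hyr.1 hyd, map_add, neg_add, map_smul,
      Y_pow_mul i ((lowers_contract C i).height_mem hyr.1), Y_pow_mul i hyr.1] at h1
    have h2 := pow_mem_of_stable (adg_mem_serreIdeal (C := C) i) (k + 1) (hP i)
    have h3 := add_mem h1 h2
    convert h3 using 1
    rw [add_right_comm, neg_add_cancel, zero_add, ← neg_smul]
    congr 1
    simp
    ring
  have hcas := casimir_smul_mem (C := C) (l := 0) (J := serreIdeal C) (w := w) (x := Y y)
    (fun i x hx => gen_mul_mem_leftSpan i hx) (fun i x hx => eop_mem_serreIdeal 0 i hx)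
    (fun j hj r hr m hm w' hw' => by
      rcases Nat.lt_or_ge (j + 2) w.length with h | h
      · exact mem_serreIdeal_mul (ih (j + 1) (by omega) hr) _
      · rw [E_zero_of_le hm (by omega), mul_zero]; exact zero_mem _)
    (Y_mem_degree hyd)
    (fun i => by
      rw [← mul_one (Y y), eop_Y_mul 0 i hyr.1, eop_one, mul_zero, mul_one, zero_sub]
      exact neg_mem (hP i))
  refine hy ((Submodule.smul_mem_iff _ (casimirScalar_ne_zero ?_ (fun i => ⟨0, by simp⟩)
    hchain)).1 hcas)
  rintro rfl
  simp at hc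

/-- The constant term. -/
noncomputable def eps : Free ι →ₗ[ℂ] ℂ := wlift (fun w => if w = [] then 1 else 0)

@[simp] theorem eps_one : eps (1 : Free ι) = 1 := by
  rw [← wd_nil, eps, wlift_wd, if_pos rfl]

@[simp] theorem eps_gen_mul (i : ι) (x : Free ι) : eps (gen i * x) = 0 := by
  refine eq_of_mem_wspan (f := eps ∘ₗ fop i) (g := 0) (fun w _ => ?_) (mem_wspan_true x)
  simp [← wd_cons, eps]

theorem eps_of_mem_degree {β : Multiset ι} (h : β ≠ 0) {x : Free ι} (hx : x ∈ degree β) :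
    eps x = 0 := by
  refine eq_of_mem_wspan (f := eps) (g := 0) (fun w hw => ?_) hx
  have : w ≠ [] := by rintro rfl; exact h hw.symm
  simp [eps, this]

theorem pr_zero (x : Free ι) : pr 0 x = eps x • 1 := by
  refine eq_of_mem_wspan (f := pr 0) (g := eps.smulRight 1) (fun w _ => ?_) (mem_wspan_true x)
  simp only [pr, wlift_wd, eps, LinearMap.smulRight_apply, Multiset.coe_eq_zero]
  split_ifs with h
  · simp [h]
  · simp

/-- Generators of the annihilator of a highest weight vector. -/
def hwSet (C : GCM ι) (n : ι → ℕ) : Set (Free ι) := serreSet C ∪ {x | ∃ i, x = gen i ^ (n i + 1)}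

/-- The annihilator of the highest weight vector of an integrable highest weight module. -/
noncomputable def hwIdeal (C : GCM ι) (n : ι → ℕ) : Submodule ℂ (Free ι) := leftSpan (hwSet C n)

theorem serreIdeal_le (n : ι → ℕ) : serreIdeal C ≤ hwIdeal C n :=
  leftSpan_mono Set.subset_union_left

theorem hwSet_homogeneous (n : ι → ℕ) : ∀ z ∈ hwSet C n, ∃ γ, γ ≠ 0 ∧ z ∈ degree γ := by
  rintro z (hz | ⟨i, rfl⟩)
  · exact serreSet_homogeneous z hz
  · exact ⟨_, by simp [Multiset.replicate_succ], gen_pow_mem_degree i _⟩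

theorem hop_one (l : ι → ℂ) (i : ι) : hop C l i 1 = l i • 1 := by
  rw [← wd_nil, hop, wlift_wd]; simp

theorem eop_mem_hwIdeal (n : ι → ℕ) (k : ι) {x : Free ι} (hx : x ∈ hwIdeal C n) :
    eop C (fun i => n i) k x ∈ hwIdeal C n := by
  refine eop_mem_leftSpan (fun z hz => (hwSet_homogeneous n z hz).imp fun _ h => h.2) k ?_ hx
  rintro z (hz | ⟨i, rfl⟩)
  · exact serreIdeal_le n (serreSet_eop _ k z hz)
  · by_cases h : k = i
    · subst h
      have := eop_pow_mul (C := C) (fun i => (n i : ℂ)) k (hop_one _ k) (n k)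
      rw [mul_one] at this
      rw [this]
      simp
    · have : ∀ m : ℕ, eop C (fun i => (n i : ℂ)) k (gen i ^ m) = 0 := by
        intro m
        induction m with
        | zero => simp
        | succ m ih => rw [pow_succ', eop_gen_mul, ih, if_neg h]; simp
      rw [this]; exact zero_mem _

theorem eps_hwIdeal (n : ι → ℕ) {x : Free ι} (hx : x ∈ hwIdeal C n) : eps x = 0 := by
  have : hwIdeal C n ≤ LinearMap.ker eps := by
    rw [hwIdeal, leftSpan, Submodule.span_le]
    rintro _ ⟨w, z, hz, rfl⟩
    obtain ⟨γ, h0, hγ⟩ := hwSet_homogeneous n z hz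
    exact eps_of_mem_degree (by simp [h0]) (mul_mem_degree (wd_mem_wspan rfl) hγ)
  exact this hx

theorem fop_nilpotent (n : ι → ℕ) (i : ι) (x : Free ι) : ∃ k, gen i ^ k * x ∈ hwIdeal C n := by
  obtain ⟨p, hp⟩ := adg_nilpotent C i x
  refine ⟨p + (n i + 1), ?_⟩
  rw [← fop_pow_apply]
  have := leibniz_pow_mem (LinearMap.mul ℂ (Free ι)) (D₁ := adg i) (D₂ := fop i) (D₃ := fop i)
    (S₁ := serreIdeal C) (S₂ := hwIdeal C n) (S₃ := hwIdeal C n)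
    (fun a b => by
      simp only [LinearMap.mul_apply', adg_apply, LinearMap.mulLeft_apply]; noncomm_ring)
    (fun a ha b => serreIdeal_le n (mem_serreIdeal_mul ha b))
    (fun a b hb => mul_mem_leftSpan a hb)
    (fun z hz => gen_mul_mem_leftSpan i hz) p (n i + 1) x 1 hp
    (by
      rw [fop_pow_apply, mul_one]
      exact subset_leftSpan (Z := hwSet C n) (Or.inr ⟨i, rfl⟩))
  simpa using this

/-- A vector killed by all raising operators modulo `hwIdeal` is a multiple of the highest weight
vector. -/
theorem sub_eps_mem_hwIdeal {n : ι → ℕ} {x : Free ι}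
    (hx : ∀ i, eop C (fun i => n i) i x ∈ hwIdeal C n) : x - eps x • 1 ∈ hwIdeal C n := by
  have hhom := pr_mem_leftSpan (Z := hwSet C n)
    fun z hz => (hwSet_homogeneous n z hz).imp fun _ h => h.2
  refine mem_of_pr fun β => ?_
  rw [← pr_zero, map_sub]
  by_cases hβ : β = 0
  · subst hβ
    rw [pr_of_mem (pr_mem 0 x), sub_self]; exact zero_mem _
  rw [pr_of_mem_ne (Ne.symm hβ) (pr_mem 0 x), sub_zero]
  have hyd := pr_mem β x
  have hey : ∀ i, eop C (fun i => n i) i (pr β x) ∈ hwIdeal C n := by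
    intro i
    by_cases hi : i ∈ β
    · rw [← Multiset.cons_erase hi, (lowers_eop _ i).pr_comm]
      exact hhom _ (hx i)
    · rw [(lowers_eop _ i).eq_zero hi hyd]; exact zero_mem _
  set y := pr β x
  obtain ⟨w, rfl⟩ := Quot.exists_rep β
  replace hyd : y ∈ degree (w : Multiset ι) := hyd
  have hw : w ≠ [] := by rintro rfl; exact hβ rfl
  by_contra hy
  have hchain : ∀ i, ∃ a : ℕ, (n i : ℂ) - arow C i w = a := by
    intro i
    refine exists_nat_of_chain (J := hwIdeal C n) (x := fun k => gen i ^ k * y)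
      (by simpa using hy) (fop_nilpotent n i _) fun k hk => ?_
    have h1 := eop_mem_hwIdeal n i hk
    rw [eop_pow_mul _ i (hop_of_mem_degree _ i hyd)] at h1
    exact (Submodule.add_mem_iff_right _ (mul_mem_leftSpan _ (hey i))).1 h1
  refine hy ((Submodule.smul_mem_iff _ (casimirScalar_ne_zero (l := fun i => (n i : ℂ)) hw
    (fun i => ⟨n i, rfl⟩) hchain)).1 (casimir_smul_mem (J := hwIdeal C n)
    (fun i x hx => gen_mul_mem_leftSpan i hx) (fun i x hx => eop_mem_hwIdeal n i hx)
    (fun j hj r hr m hm w' hw' => serreIdeal_le n (mem_serreIdeal_mul (Y_rad hr) _)) hyd hey))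

/-- The action of the free algebra defined by a family of operators. -/
noncomputable abbrev act {V : Type*} [AddCommGroup V] [Module ℂ V] (f : ι → Module.End ℂ V) :
    Free ι →ₐ[ℂ] Module.End ℂ V := FreeAlgebra.lift ℂ f

theorem act_gen {V : Type*} [AddCommGroup V] [Module ℂ V] (f : ι → Module.End ℂ V) (i : ι) :
    act f (gen i) = f i := FreeAlgebra.lift_ι_apply f i

theorem act_gen_mul {V : Type*} [AddCommGroup V] [Module ℂ V] (f : ι → Module.End ℂ V) (i : ι)
    (x : Free ι) (v : V) : act f (gen i * x) v = f i (act f x v) := by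
  rw [map_mul, act_gen, Module.End.mul_apply]

theorem exists_word_not_mem {V : Type*} [AddCommGroup V] [Module ℂ V] (e : ι → Module.End ℂ V)
    {J : Submodule ℂ V} {x : V} (hx : x ∉ J) (N : ℕ)
    (hN : ∀ w : List ι, w.length = N → act e (wd w) x ∈ J) :
    ∃ w, act e (wd w) x ∉ J ∧ ∀ i, e i (act e (wd w) x) ∈ J := by
  induction N generalizing x with
  | zero => exact absurd (by simpa using hN [] rfl) hx
  | succ N ih =>
    by_cases h : ∀ i, e i x ∈ J
    · exact ⟨[], by simpa using hx, by simpa using h⟩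
    · push Not at h
      obtain ⟨i, hi⟩ := h
      have hcat : ∀ w, act e (wd w) (e i x) = act e (wd (w ++ [i])) x := fun w => by
        rw [wd_append, map_mul, wd_singleton, act_gen, Module.End.mul_apply]
      obtain ⟨w, hw⟩ := ih hi fun w hw => by rw [hcat]; exact hN _ (by simp [hw])
      exact ⟨w ++ [i], by simpa only [hcat] using hw⟩

/-- Vectors killed by all sufficiently long words in a family of operators. -/
def locNil {V : Type*} [AddCommGroup V] [Module ℂ V] (e : ι → Module.End ℂ V) :
    Submodule ℂ V where
  carrier := {x | ∃ N : ℕ, ∀ w : List ι, N ≤ w.length → act e (wd w) x = 0}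
  zero_mem' := ⟨0, by simp⟩
  add_mem' := by
    rintro a b ⟨p, hp⟩ ⟨q, hq⟩
    exact ⟨p + q, fun w hw => by rw [map_add, hp w (by omega), hq w (by omega), add_zero]⟩
  smul_mem' := by
    rintro c a ⟨p, hp⟩
    exact ⟨p, fun w hw => by rw [map_smul, hp w hw, smul_zero]⟩

theorem mem_locNil_eop (l : ι → ℂ) (x : Free ι) : x ∈ locNil (ι := ι) (eop C l) := by
  refine map_mem_of_wd (f := LinearMap.id) (N := locNil (eop C l)) (fun v =>
    (⟨v.length + 1, fun w hw => ?_⟩ : ∃ N : ℕ, ∀ w : List ι, N ≤ w.length →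
      act (eop C l) (wd w) (wd v) = 0)) x
  have key : ∀ w : List ι, act (eop C l) (wd w) (wd v) ∈
      wspan (fun u : List ι => u.length + w.length = v.length) := by
    intro w
    induction w with
    | nil => simpa using wd_mem_wspan (by simp)
    | cons i w ih =>
      rw [wd_cons, act_gen_mul]
      refine map_mem_of_mem_wspan (fun u hu => ?_) ih
      match u, hu with
      | [], _ => simp
      | j :: u, hu =>
        have := (lowers_eop (C := C) l i).height_mem (wd_mem_wspan (w := j :: u)
          (P := fun w' : List ι => w'.length = u.length + 1) rfl)
        refine mem_of_mem_wspan (fun u' hu' => wd_mem_wspan ?_) this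
        simp only [List.length_cons] at hu ⊢
        omega
  have := map_mem_of_mem_wspan (f := LinearMap.id) (N := ⊥) (fun u hu => by omega) (key w)
  simpa using this

/-- Operators satisfying the relations between Chevalley generators, with the Serre relations for
the lowering operators. -/
structure IsTriple (C : GCM ι) {V : Type*} [AddCommGroup V] [Module ℂ V]
    (e f h : ι → Module.End ℂ V) : Prop where
  e_f : ∀ i j x, e i (f j x) = f j (e i x) + if i = j then h i x else 0
  h_f : ∀ i j x, h i (f j x) = f j (h i x) - (C.A i j : ℂ) • f j x
  serre : ∀ i j, i ≠ j → act f (serre C i j) = 0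

section Triple

variable {V : Type*} [AddCommGroup V] [Module ℂ V] {e f h : ι → Module.End ℂ V} {n : ι → ℕ} {u : V}

theorem IsTriple.h_act (hT : IsTriple C e f h) {l : ι → ℂ} (hu : ∀ i, h i u = l i • u) (i : ι)
    (x : Free ι) : h i (act f x u) = act f (hop C l i x) u := by
  refine eq_of_mem_wspan (f := h i ∘ₗ LinearMap.applyₗ u ∘ₗ (act f).toLinearMap)
    (g := LinearMap.applyₗ u ∘ₗ (act f).toLinearMap ∘ₗ hop C l i) (fun w _ => ?_)
    (mem_wspan_true x)
  simp only [LinearMap.comp_apply, AlgHom.toLinearMap_apply, LinearMap.applyₗ_apply_apply]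
  induction w with
  | nil => simp [hop_one, hu]
  | cons j w ih =>
    simp only [hop, wlift_wd, map_smul, LinearMap.smul_apply] at ih ⊢
    rw [wd_cons, act_gen_mul, hT.h_f, ih, map_smul, ← sub_smul, arow_cons]
    congr 1
    ring

theorem IsTriple.e_act (hT : IsTriple C e f h) {l : ι → ℂ} (hu : ∀ i, h i u = l i • u)
    (heu : ∀ i, e i u = 0) (i : ι) (x : Free ι) :
    e i (act f x u) = act f (eop C l i x) u := by
  refine eq_of_mem_wspan (f := e i ∘ₗ LinearMap.applyₗ u ∘ₗ (act f).toLinearMap)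
    (g := LinearMap.applyₗ u ∘ₗ (act f).toLinearMap ∘ₗ eop C l i) (fun w _ => ?_)
    (mem_wspan_true x)
  simp only [LinearMap.comp_apply, AlgHom.toLinearMap_apply, LinearMap.applyₗ_apply_apply]
  induction w with
  | nil => simp [heu]
  | cons j w ih =>
    rw [wd_cons, act_gen_mul, hT.e_f, ih, eop_gen_mul, map_add, LinearMap.add_apply, act_gen_mul]
    congr 1
    split_ifs
    · exact hT.h_act hu i _
    · simp

theorem IsTriple.e_word_act (hT : IsTriple C e f h) {l : ι → ℂ} (hu : ∀ i, h i u = l i • u)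
    (heu : ∀ i, e i u = 0) (w : List ι) (x : Free ι) :
    act e (wd w) (act f x u) = act f (act (eop C l) (wd w) x) u := by
  induction w with
  | nil => simp
  | cons i w ih => rw [wd_cons, act_gen_mul, ih, hT.e_act hu heu, act_gen_mul]

theorem act_hwIdeal {g : ι → Module.End ℂ V} (hs : ∀ i j, i ≠ j → act g (serre C i j) = 0)
    (hp : ∀ i, (g i ^ (n i + 1)) u = 0) {x : Free ι} (hx : x ∈ hwIdeal C n) : act g x u = 0 := by
  have key : hwIdeal C n ≤ LinearMap.ker (LinearMap.applyₗ u ∘ₗ (act g).toLinearMap) := by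
    rw [hwIdeal, leftSpan, Submodule.span_le]
    rintro _ ⟨w, z, hz, rfl⟩
    suffices h : act g z u = 0 by
      simp [map_mul, h]
    rcases hz with ⟨i, j, w, hij, rfl⟩ | ⟨i, rfl⟩
    · rw [map_mul, hs i j hij, zero_mul, LinearMap.zero_apply]
    · rw [map_pow, act_gen, hp]
  exact key hx

theorem IsTriple.act_eq_zero (hT : IsTriple C e f h) (hu : ∀ i, h i u = (n i : ℂ) • u)
    (heu : ∀ i, e i u = 0) (hf : ∀ i, ∃ k, (f i ^ k) u = 0) {x : Free ι} (hx : x ∈ hwIdeal C n) :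
    act f x u = 0 := by
  refine act_hwIdeal hT.serre (fun i => ?_) hx
  by_contra h0
  have he' : ∀ x, e i (f i x) = f i (e i x) + h i x := fun x => by rw [hT.e_f, if_pos rfl]
  have hh' : ∀ x, h i (f i x) = f i (h i x) - (2 : ℂ) • f i x := fun x => by
    rw [hT.h_f, C.diag]; norm_cast
  have h1 : e i ((f i ^ (n i + 1)) u) = 0 := by
    rw [sl2_apply_pow he' hh' (hu i), heu]; simp
  have h2 : h i ((f i ^ (n i + 1)) u) = (-(n i : ℂ) - 2) • (f i ^ (n i + 1)) u := by
    have := hT.h_act hu i (gen i ^ (n i + 1))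
    rw [map_pow, act_gen] at this
    have hd := gen_pow_mem_degree i (n i + 1)
    rw [← Multiset.coe_replicate] at hd
    rw [this, hop_of_mem_degree _ i hd, map_smul, LinearMap.smul_apply, map_pow, act_gen]
    congr 1
    simp [arow, C.diag]
    ring
  obtain ⟨m, hm⟩ := exists_nat_of_chain (J := (⊥ : Submodule ℂ V))
    (x := fun k => (f i ^ k) ((f i ^ (n i + 1)) u)) (c := -(n i : ℂ) - 2) (by simpa using h0)
    (by
      obtain ⟨k, hk⟩ := hf i
      refine ⟨k, ?_⟩
      rw [← Module.End.mul_apply, ← pow_add, add_comm, pow_add, Module.End.mul_apply, hk]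
      simp)
    (fun k hk => by
      rw [Submodule.mem_bot] at hk ⊢
      have := sl2_apply_pow he' hh' h2 k
      rw [hk, h1] at this
      simpa using this.symm)
  have : ((m + n i + 2 : ℕ) : ℂ) = 0 := by push_cast; rw [← hm]; ring
  have := Nat.cast_eq_zero.1 this
  omega

theorem IsTriple.act_eq_zero_iff (hT : IsTriple C e f h) (hu : ∀ i, h i u = (n i : ℂ) • u)
    (heu : ∀ i, e i u = 0) (hf : ∀ i, ∃ k, (f i ^ k) u = 0) (hu0 : u ≠ 0) (x : Free ι) :
    act f x u = 0 ↔ x ∈ hwIdeal C n := by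
  refine ⟨fun hx => ?_, hT.act_eq_zero hu heu hf⟩
  by_contra hxJ
  obtain ⟨N, hN⟩ := mem_locNil_eop (C := C) (fun i => (n i : ℂ)) x
  obtain ⟨w, hw, hw'⟩ := exists_word_not_mem (eop C fun i => (n i : ℂ)) hxJ N
    fun w hw => by rw [hN w hw.ge]; exact zero_mem _
  have h1 := sub_eps_mem_hwIdeal hw'
  have h2 := hT.act_eq_zero hu heu hf h1
  have h3 := hT.e_word_act hu heu w x
  rw [hx, map_zero] at h3
  rw [map_sub, LinearMap.sub_apply, ← h3, zero_sub, neg_eq_zero, map_smul, map_one,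
    LinearMap.smul_apply, Module.End.one_apply, smul_eq_zero] at h2
  rw [h2.resolve_right hu0, zero_smul, sub_zero] at h1
  exact hw h1

end Triple

/-- Values on words of the Shapovalov form. -/
noncomputable def shapWord (C : GCM ι) (l : ι → ℂ) : List ι → (Free ι →ₗ[ℂ] ℂ)
  | [] => eps
  | i :: w => shapWord C l w ∘ₗ eop C l i

/-- The Shapovalov form. -/
noncomputable def shap (C : GCM ι) (l : ι → ℂ) : Free ι →ₗ[ℂ] Free ι →ₗ[ℂ] ℂ :=
  wlift (shapWord C l)

theorem shap_one (l : ι → ℂ) (x : Free ι) : shap C l 1 x = eps x := by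
  rw [← wd_nil, shap, wlift_wd, shapWord]

theorem shap_gen_mul (l : ι → ℂ) (i : ι) (m x : Free ι) :
    shap C l (gen i * m) x = shap C l m (eop C l i x) := by
  refine eq_of_mem_wspan (f := (shap C l).flip x ∘ₗ fop i) (g := (shap C l).flip (eop C l i x))
    (fun w _ => ?_) (mem_wspan_true m)
  simp [← wd_cons, shap, shapWord]

theorem shap_degree (l : ι → ℂ) {w : List ι} {β : Multiset ι} (h : β ≠ w) {x : Free ι}
    (hx : x ∈ degree β) : shap C l (wd w) x = 0 := by
  induction w generalizing β x with
  | nil => rw [wd_nil, shap_one, eps_of_mem_degree h hx]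
  | cons j w ih =>
    rw [wd_cons, shap_gen_mul]
    by_cases hj : j ∈ β
    · rw [← Multiset.cons_erase hj] at hx
      refine ih (fun h' => h ?_) ((lowers_eop l j).mem hx)
      rw [← Multiset.cons_erase hj, h', Multiset.cons_coe]
    · rw [(lowers_eop l j).eq_zero hj hx, map_zero]

theorem shap_diagonal (l : ι → ℂ) {T : Free ι →ₗ[ℂ] Free ι}
    (hT : ∀ β : Multiset ι, ∃ c : ℂ, ∀ x ∈ degree β, T x = c • x) (m x : Free ι) :
    shap C l m (T x) = shap C l (T m) x := by
  refine eq_of_mem_wspan (f := (shap C l).flip (T x)) (g := (shap C l).flip x ∘ₗ T)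
    (fun w _ => ?_) (mem_wspan_true m)
  refine eq_of_mem_wspan (f := shap C l (wd w) ∘ₗ T) (g := shap C l (T (wd w)))
    (fun w' _ => ?_) (mem_wspan_true x)
  obtain ⟨c, hc⟩ := hT w
  obtain ⟨c', hc'⟩ := hT w'
  rw [LinearMap.comp_apply, hc _ (wd_mem_wspan rfl), hc' _ (wd_mem_wspan rfl), map_smul, map_smul,
    LinearMap.smul_apply]
  by_cases h : (w' : Multiset ι) = w
  · by_cases h0 : wd w' = (0 : Free ι)
    · simp [h0]
    · congr 1
      have h1 := hc _ (wd_mem_wspan h)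
      rw [hc' _ (wd_mem_wspan rfl)] at h1
      exact smul_left_injective ℂ h0 h1
  · rw [shap_degree l h (wd_mem_wspan rfl)]; simp

theorem hop_diagonal (l : ι → ℂ) (i : ι) (β : Multiset ι) :
    ∃ c : ℂ, ∀ x ∈ degree β, hop C l i x = c • x := by
  obtain ⟨w, rfl⟩ := Quot.exists_rep β
  exact ⟨_, fun x hx => hop_of_mem_degree l i hx⟩

theorem shap_adjoint (l : ι → ℂ) (i : ι) (m x : Free ι) :
    shap C l m (gen i * x) = shap C l (eop C l i m) x := by
  refine eq_of_mem_wspan (f := (shap C l).flip (gen i * x)) (g := (shap C l).flip x ∘ₗ eop C l i)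
    (fun w _ => ?_) (mem_wspan_true m)
  simp only [LinearMap.flip_apply, LinearMap.comp_apply]
  induction w generalizing x with
  | nil => simp [shap_one]
  | cons j w ih =>
    rw [wd_cons, shap_gen_mul, eop_gen_mul, eop_gen_mul, map_add, map_add, ih,
      LinearMap.add_apply, shap_gen_mul]
    congr 1
    by_cases h : i = j
    · subst h
      rw [if_pos rfl, if_pos rfl, shap_diagonal l (hop_diagonal l i)]
    · simp [h, Ne.symm h]

theorem shap_symm (l : ι → ℂ) (x y : Free ι) : shap C l x y = shap C l y x := by
  refine eq_of_mem_wspan (f := (shap C l).flip y) (g := shap C l y)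
    (fun w _ => ?_) (mem_wspan_true x)
  rw [LinearMap.flip_apply]
  induction w generalizing y with
  | nil =>
    refine eq_of_mem_wspan (f := shap C l (wd [])) (g := (shap C l).flip (wd []))
      (fun w _ => ?_) (mem_wspan_true y)
    rw [LinearMap.flip_apply]
    cases w with
    | nil => rfl
    | cons j w => rw [wd_nil, shap_one, wd_cons, shap_gen_mul]; simp
  | cons j w ih => rw [wd_cons, shap_gen_mul, ih, shap_adjoint]

theorem exists_shap_eq (l : ι → ℂ) (w : List ι) (m : Free ι) :
    ∃ m', ∀ x, shap C l m (act (eop C l) (wd w) x) = shap C l m' x := by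
  induction w generalizing m with
  | nil => exact ⟨m, by simp⟩
  | cons i w ih =>
    obtain ⟨m', hm'⟩ := ih (gen i * m)
    exact ⟨m', fun x => by rw [wd_cons, act_gen_mul, ← shap_gen_mul, hm']⟩

theorem mem_hwIdeal_of_shap (n : ι → ℕ) {x : Free ι}
    (hx : ∀ m, shap C (fun i => (n i : ℂ)) m x = 0) : x ∈ hwIdeal C n := by
  by_contra hxJ
  obtain ⟨N, hN⟩ := mem_locNil_eop (C := C) (fun i => (n i : ℂ)) x
  obtain ⟨w, hw, hw'⟩ := exists_word_not_mem (eop C fun i => (n i : ℂ)) hxJ N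
    fun w hw => by rw [hN w hw.ge]; exact zero_mem _
  have h1 := sub_eps_mem_hwIdeal hw'
  obtain ⟨m', hm'⟩ := exists_shap_eq (C := C) (fun i => (n i : ℂ)) w 1
  have h2 := hm' x
  rw [hx, shap_one] at h2
  rw [h2, zero_smul, sub_zero] at h1
  exact hw h1

theorem radOn_shap_le (n : ι → ℕ) (N : ℕ) :
    radOn (shap C (fun i => (n i : ℂ))) (height ι N) ≤ hwIdeal C n := by
  rintro x ⟨hx, hx'⟩
  refine mem_hwIdeal_of_shap n fun m => ?_
  refine eq_of_mem_wspan (f := (shap C fun i => (n i : ℂ)).flip x) (g := 0) (fun w _ => ?_) (mem_wspan_true m)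
  rw [LinearMap.flip_apply, LinearMap.zero_apply]
  by_cases hw : w.length = N
  · exact hx' _ (wd_mem_wspan hw)
  · refine eq_of_mem_wspan (f := shap C (fun i => (n i : ℂ)) (wd w)) (g := 0) (fun w' hw' => ?_) hx
    refine shap_degree _ (fun h => hw ?_) (wd_mem_wspan rfl)
    rw [← hw', (Multiset.coe_eq_coe.1 h).length_eq]

theorem mem_hwIdeal_of_eps (n : ι → ℕ) {x : Free ι}
    (hx : ∀ w, eps (act (eop C fun i => (n i : ℂ)) (wd w) x) = 0) : x ∈ hwIdeal C n := by
  by_contra hxJ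
  obtain ⟨N, hN⟩ := mem_locNil_eop (C := C) (fun i => (n i : ℂ)) x
  obtain ⟨w, hw, hw'⟩ := exists_word_not_mem (eop C fun i => (n i : ℂ)) hxJ N
    fun w hw => by rw [hN w hw.ge]; exact zero_mem _
  have h1 := sub_eps_mem_hwIdeal hw'
  rw [hx w, zero_smul, sub_zero] at h1
  exact hw h1

theorem shap_hwIdeal (n : ι → ℕ) (m : Free ι) {x : Free ι} (hx : x ∈ hwIdeal C n) :
    shap C (fun i => (n i : ℂ)) m x = 0 := by
  refine eq_of_mem_wspan (f := (shap C fun i => (n i : ℂ)).flip x) (g := 0) (fun w _ => ?_)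
    (mem_wspan_true m)
  rw [LinearMap.flip_apply, LinearMap.zero_apply]
  induction w generalizing x with
  | nil => rw [wd_nil, shap_one, eps_hwIdeal n hx]
  | cons i w ih => rw [wd_cons, shap_gen_mul, ih (eop_mem_hwIdeal n i hx)]

theorem eps_eop_pow (n : ι → ℕ) (i : ι) (x : Free ι) :
    eps ((eop C (fun i => (n i : ℂ)) i ^ (n i + 1)) x) = 0 := by
  have h : ∀ (k : ℕ) (m : Free ι), shap C (fun i => (n i : ℂ)) m
      ((eop C (fun i => (n i : ℂ)) i ^ k) x) = shap C (fun i => (n i : ℂ)) (gen i ^ k * m) x := by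
    intro k
    induction k with
    | zero => simp
    | succ k ih =>
      intro m
      rw [pow_succ', Module.End.mul_apply, ← shap_gen_mul, ih, pow_succ, mul_assoc]
  rw [← shap_one (C := C) (fun i => (n i : ℂ)), h, mul_one, shap_symm]
  exact shap_hwIdeal n _ (subset_leftSpan (Z := hwSet C n) (Or.inr ⟨i, rfl⟩))

/-- The diagonal operator multiplying a word by the sum of the weights of its letters. -/
noncomputable def wtOp (a : ι → ℂ) : Module.End ℂ (Free ι) := wlift fun w => (w.map a).sum • wd w

theorem wtOp_of_mem_degree (a : ι → ℂ) {β : Multiset ι} {x : Free ι} (hx : x ∈ degree β) :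
    wtOp a x = (β.map a).sum • x := by
  refine eq_of_mem_wspan (f := wtOp a) (g := (β.map a).sum • LinearMap.id) (fun w hw => ?_) hx
  rw [wtOp, wlift_wd, LinearMap.smul_apply, LinearMap.id_apply, ← hw, Multiset.map_coe,
    Multiset.sum_coe]

theorem wtOp_mem_height (a : ι → ℂ) {N : ℕ} {x : Free ι} (hx : x ∈ height ι N) :
    wtOp a x ∈ height ι N := by
  refine map_mem_of_mem_wspan (fun w hw => ?_) hx
  rw [wtOp, wlift_wd]
  exact Submodule.smul_mem _ _ (wd_mem_wspan hw)

theorem eps_wtOp (a : ι → ℂ) (x : Free ι) : eps (wtOp a x) = 0 := by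
  refine eq_of_mem_wspan (f := eps ∘ₗ wtOp a) (g := 0) (fun w _ => ?_) (mem_wspan_true x)
  rw [LinearMap.comp_apply, wtOp, wlift_wd]
  cases w with
  | nil => simp
  | cons i w => simp [wd_cons]

theorem eop_height_zero (l : ι → ℂ) (i : ι) {x : Free ι} (hx : x ∈ height ι 0) :
    eop C l i x = 0 := by
  refine eq_of_mem_wspan (f := eop C l i) (g := 0) (fun w hw => ?_) hx
  rw [List.length_eq_zero_iff.1 hw]; simp [eop_one]

theorem eps_height_succ {N : ℕ} {x : Free ι} (hx : x ∈ height ι (N + 1)) : eps x = 0 := by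
  refine eq_of_mem_wspan (f := eps) (g := 0) (fun w hw => ?_) hx
  match w, hw with
  | i :: w, _ => rw [wd_cons]; simp

section Action

variable {V W : Type*} [AddCommGroup V] [Module ℂ V] [AddCommGroup W] [Module ℂ W]

theorem map_act (g : ι → Module.End ℂ V) (T : Module.End ℂ V) {a : ι → ℂ} {l : ℂ} {u : V}
    (hT : ∀ i x, T (g i x) = g i (T x) + a i • g i x) (hu : T u = l • u) (x : Free ι) :
    T (act g x u) = l • act g x u + act g (wtOp a x) u := by
  refine eq_of_mem_wspan (f := T ∘ₗ LinearMap.applyₗ u ∘ₗ (act g).toLinearMap)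
    (g := l • (LinearMap.applyₗ u ∘ₗ (act g).toLinearMap) +
      (LinearMap.applyₗ u ∘ₗ (act g).toLinearMap) ∘ₗ wtOp a) (fun w _ => ?_) (mem_wspan_true x)
  simp only [LinearMap.comp_apply, AlgHom.toLinearMap_apply, LinearMap.applyₗ_apply_apply,
    LinearMap.add_apply, LinearMap.smul_apply]
  induction w with
  | nil => rw [wtOp, wlift_wd]; simp [hu]
  | cons j w ih =>
    simp only [wtOp, wlift_wd, map_smul, LinearMap.smul_apply] at ih ⊢
    rw [wd_cons, act_gen_mul, hT, ih, map_add, map_smul, map_smul, List.map_cons, List.sum_cons]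
    module

theorem act_neg_wd (g : ι → Module.End ℂ V) (w : List ι) :
    act (fun i => -g i) (wd w) = (-1 : ℂ) ^ w.length • act g (wd w) := by
  induction w with
  | nil => simp
  | cons i w ih =>
    rw [wd_cons, map_mul, map_mul, act_gen, act_gen, ih, List.length_cons, pow_succ]
    simp

/-- Contraction of the first factor of a tensor product with a linear functional. -/
noncomputable def contractFst (ξ : V →ₗ[ℂ] ℂ) : V ⊗[ℂ] W →ₗ[ℂ] W :=
  TensorProduct.lift (LinearMap.lsmul ℂ W ∘ₗ ξ)

theorem contractFst_tmul (ξ : V →ₗ[ℂ] ℂ) (a : V) (b : W) :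
    contractFst ξ (a ⊗ₜ[ℂ] b) = ξ a • b := rfl

theorem contractFst_smul (c : ℂ) (ξ : V →ₗ[ℂ] ℂ) (z : V ⊗[ℂ] W) :
    contractFst (c • ξ) z = c • contractFst ξ z := by
  rw [contractFst, contractFst, LinearMap.comp_smul]
  induction z with
  | zero => simp
  | add a b ha hb => simp only [map_add, smul_add, ha, hb]
  | tmul a b => simp

theorem eq_zero_of_contractFst {w : V ⊗[ℂ] W} {Ξ : Set (V →ₗ[ℂ] ℂ)}
    (hΞ : ∀ a, (∀ ξ ∈ Ξ, ξ a = 0) → a = 0) (hw : ∀ ξ ∈ Ξ, contractFst ξ w = 0) : w = 0 := by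
  classical
  let b := Module.Basis.ofVectorSpace ℂ W
  let E := TensorProduct.equivFinsuppOfBasisRight (M := V) b
  have hE : ∀ ξ : V →ₗ[ℂ] ℂ, ∀ z, ∀ k, b.repr (contractFst ξ z) k = ξ (E z k) := by
    intro ξ z k
    induction z with
    | zero => simp
    | add x y hx hy => simp only [map_add, Finsupp.add_apply, hx, hy]
    | tmul x y =>
      rw [contractFst_tmul, TensorProduct.equivFinsuppOfBasisRight_apply_tmul_apply]
      simp [mul_comm]
  refine E.injective ?_
  rw [map_zero]
  ext k
  exact hΞ _ fun ξ hξ => by rw [← hE, hw ξ hξ]; simp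

theorem exists_factor {A : Type*} [AddCommGroup A] [Module ℂ A] {p : A →ₗ[ℂ] V}
    (hp : Function.Surjective p) (q : A →ₗ[ℂ] W) (hq : ∀ a, p a = 0 → q a = 0) :
    ∃ φ : V →ₗ[ℂ] W, ∀ a, φ (p a) = q a := by
  obtain ⟨s, hs⟩ := LinearMap.exists_rightInverse_of_surjective p (LinearMap.range_eq_top.2 hp)
  refine ⟨q ∘ₗ s, fun a => ?_⟩
  have := hq (s (p a) - a) (by
    rw [map_sub, sub_eq_zero]; exact LinearMap.congr_fun hs (p a))
  rw [map_sub, sub_eq_zero] at this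
  exact this

/-- The canonical element of `V ⊗ W` attached to a highest weight vector of `V` and a vector of `W`
killed by the same ideal. -/
theorem exists_canonical {f : ι → Module.End ℂ V} {g : ι → Module.End ℂ W} {v : V} {u : W}
    {n : ι → ℕ} (hv : ∀ x ∈ hwIdeal C n, act f x v = 0) (hu : ∀ x ∈ hwIdeal C n, act g x u = 0)
    {N : ℕ} (hN : ∀ w : List ι, N ≤ w.length → act g (wd w) u = 0) :
    ∃ z : V ⊗[ℂ] W,
      (∀ ξ : V →ₗ[ℂ] ℂ, (∀ x, ξ (act f x v) = eps x) → contractFst ξ z = u) ∧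
      (∀ (i : ι) (E : Module.End ℂ V) (G : Module.End ℂ (V ⊗[ℂ] W)),
        (∀ x, E (act f x v) = act f (eop C (fun i => n i) i x) v) →
        (∀ a b, G (a ⊗ₜ b) = E a ⊗ₜ b - a ⊗ₜ g i b) → G z = 0) ∧
      (∀ (a : ι → ℂ) (S : Module.End ℂ V) (T : Module.End ℂ W) (G : Module.End ℂ (V ⊗[ℂ] W))
        (p q : ℂ), (∀ x, S (act f x v) = p • act f x v - act f (wtOp a x) v) →
        (∀ x, T (act g x u) = q • act g x u + act g (wtOp a x) u) →
        (∀ x y, G (x ⊗ₜ y) = S x ⊗ₜ y + x ⊗ₜ T y) → G z = (p + q) • z) := by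
  have hD : ∀ k, Nonempty (DualFamily (shap C fun i => (n i : ℂ)) (height ι k)) := fun k =>
    exists_dualFamily _ _ fun x _ y _ => shap_symm _ x y
  replace hD := fun k => (hD k).some
  let Φ : Free ι →ₗ[ℂ] Free ι →ₗ[ℂ] V ⊗[ℂ] W :=
    (TensorProduct.mk ℂ V W).compl₁₂ (LinearMap.applyₗ v ∘ₗ (act f).toLinearMap)
      (LinearMap.applyₗ u ∘ₗ (act g).toLinearMap)
  have hΦ : ∀ x y, Φ x y = act f x v ⊗ₜ act g y u := fun x y => rfl
  have hl : ∀ k, ∀ r ∈ radOn (shap C fun i => (n i : ℂ)) (height ι k), ∀ y, Φ r y = 0 :=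
    fun k r hr y => by rw [hΦ, hv r (radOn_shap_le n k hr), zero_tmul]
  have hr : ∀ k, ∀ x, ∀ r ∈ radOn (shap C fun i => (n i : ℂ)) (height ι k), Φ x r = 0 :=
    fun k x r hr => by rw [hΦ, hu r (radOn_shap_le n k hr), tmul_zero]
  refine ⟨∑ k ∈ Finset.range (N + 1), ∑ s, Φ ((hD k).y s) ((hD k).m s), ?_, ?_, ?_⟩
  · intro ξ hξ
    rw [Finset.sum_range_succ', map_add, map_sum, Finset.sum_eq_zero, zero_add]
    · have h1 := hu _ (radOn_shap_le n 0 ((hD 0).sub_mem' 1 (wd_mem_wspan (w := []) rfl)))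
      rw [map_sub, LinearMap.sub_apply, map_one, Module.End.one_apply, sub_eq_zero] at h1
      refine Eq.trans ?_ h1.symm
      rw [map_sum, map_sum, LinearMap.sum_apply]
      refine Finset.sum_congr rfl fun s _ => ?_
      rw [hΦ, contractFst_tmul, hξ, shap_one, map_smul, LinearMap.smul_apply]
    · intro k _
      rw [map_sum]
      refine Finset.sum_eq_zero fun s _ => ?_
      rw [hΦ, contractFst_tmul, hξ, eps_height_succ ((hD _).y_mem s), zero_smul]
  · intro i E G hE hG
    have h1 : ∀ k, ∑ s, Φ (eop C (fun i => n i) i ((hD (k + 1)).y s)) ((hD (k + 1)).m s) =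
        ∑ s, Φ ((hD k).y s) (gen i * (hD k).m s) := fun k =>
      (hD (k + 1)).exchange (hD k) Φ (eop C (fun i => n i) i) (fop i)
        (fun x hx => (lowers_eop _ i).height_mem hx) (fun x hx => gen_mul_mem_height i hx)
        (fun t _ x _ => (shap_gen_mul _ i t x).symm) (fun r hr' y _ => hl k r hr' y)
        (fun x _ r hr' => hr _ x r hr')
    have h2 : ∀ k, G (∑ s, Φ ((hD k).y s) ((hD k).m s)) =
        ∑ s, Φ (eop C (fun i => n i) i ((hD k).y s)) ((hD k).m s) -
          ∑ s, Φ ((hD k).y s) (gen i * (hD k).m s) := by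
      intro k
      rw [map_sum, ← Finset.sum_sub_distrib]
      refine Finset.sum_congr rfl fun s _ => ?_
      rw [hΦ, hG, hE, hΦ, hΦ, act_gen_mul]
    rw [map_sum, Finset.sum_congr rfl fun k _ => h2 k, Finset.sum_sub_distrib,
      Finset.sum_range_succ', Finset.sum_congr rfl fun k _ => h1 k, Finset.sum_range_succ]
    have h3 : ∑ s, Φ (eop C (fun i => n i) i ((hD 0).y s)) ((hD 0).m s) = 0 :=
      Finset.sum_eq_zero fun s _ => by
        rw [eop_height_zero _ i ((hD 0).y_mem s), map_zero, LinearMap.zero_apply]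
    have h4 : ∑ s, Φ ((hD N).y s) (gen i * (hD N).m s) = 0 :=
      Finset.sum_eq_zero fun s _ => by
        have : act g (gen i * (hD N).m s) u = 0 :=
          eq_of_mem_wspan (f := LinearMap.applyₗ u ∘ₗ (act g).toLinearMap) (g := 0)
            (fun w hw => hN w (by omega)) (gen_mul_mem_height i ((hD N).m_mem s))
        rw [hΦ, this, tmul_zero]
    rw [h3, h4]; simp
  · intro a S T G p q hS hT hG
    rw [map_sum, Finset.smul_sum]
    refine Finset.sum_congr rfl fun k _ => ?_
    have h1 := (hD k).exchange (hD k) Φ (wtOp a) (wtOp a) (fun x hx => wtOp_mem_height a hx)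
      (fun x hx => wtOp_mem_height a hx)
      (fun t _ x _ => shap_diagonal _ (fun β => ⟨_, fun x hx => wtOp_of_mem_degree a hx⟩) t x)
      (fun r hr' y _ => hl k r hr' y) (fun x _ r hr' => hr k x r hr')
    have h2 : G (∑ s, Φ ((hD k).y s) ((hD k).m s)) =
        (p + q) • ∑ s, Φ ((hD k).y s) ((hD k).m s) -
          ∑ s, Φ (wtOp a ((hD k).y s)) ((hD k).m s) +
          ∑ s, Φ ((hD k).y s) (wtOp a ((hD k).m s)) := by
      rw [map_sum, Finset.smul_sum, ← Finset.sum_sub_distrib, ← Finset.sum_add_distrib]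
      refine Finset.sum_congr rfl fun s _ => ?_
      simp only [hΦ]
      rw [hG, hS, hT, sub_tmul, tmul_add, tmul_smul, ← smul_tmul', add_smul]
      abel
    rw [h2, h1]; abel

end Action

section Realization

variable (R : KacMoodyRealization ι C 𝔤)

/-- The values of the simple roots. -/
theorem exists_root (h : R.H) : ∃ a : ι → ℂ, ∀ j, ⁅(h : 𝔤), R.e j⁆ = a j • R.e j ∧
    ⁅(h : 𝔤), R.f j⁆ = (-a j) • R.f j := by
  suffices H : ∀ j, ∃ a : ℂ, ⁅(h : 𝔤), R.e j⁆ = a • R.e j ∧ ⁅(h : 𝔤), R.f j⁆ = (-a) • R.f j by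
    choose a ha using H
    exact ⟨a, ha⟩
  intro j
  obtain ⟨c, hc⟩ := R.root_vec_e h j
  obtain ⟨c', hc'⟩ := R.root_vec_f h j
  by_cases h0 : (R.coroot j : 𝔤) = 0
  · have he := R.coroot_e j j
    have hf := R.coroot_f j j
    rw [h0, zero_lie, C.diag, eq_comm, smul_eq_zero] at he hf
    have he' : R.e j = 0 := he.resolve_left (by norm_num)
    have hf' : R.f j = 0 := hf.resolve_left (by norm_num)
    exact ⟨0, by simp [he'], by simp [hf']⟩
  · have h1 := R.abelian h (R.coroot j)
    have h2 := R.e_f j j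
    rw [if_pos rfl] at h2
    rw [← h2, leibniz_lie, hc, hc', smul_lie, lie_smul, h2, ← add_smul, smul_eq_zero] at h1
    have h3 : c' = -c := by linear_combination h1.resolve_right h0
    exact ⟨c, hc, h3 ▸ hc'⟩

section Module

variable (M : Type) [AddCommGroup M] [Module ℂ M] [LieRingModule 𝔤 M] [LieModule ℂ 𝔤 M]

theorem act_serre {g : ι → 𝔤} {i j : ι}
    (hg : ((LieAlgebra.ad ℂ 𝔤 (g i)) ^ (1 - C.A i j).toNat) (g j) = 0) :
    act (fun i => LieModule.toEnd ℂ 𝔤 M (g i)) (serre C i j) = 0 := by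
  have h1 : ∀ N : ℕ, nest g (gen i ^ N * gen j) = ((LieAlgebra.ad ℂ 𝔤 (g i)) ^ N) (g j) := by
    intro N
    have hN : ∀ N : ℕ, gen i ^ N * gen j ∈ height ι (N + 1) := by
      intro N
      induction N with
      | zero => simpa using gen_mem_height j
      | succ N ih => rw [pow_succ', mul_assoc]; exact gen_mul_mem_height i ih
    induction N with
    | zero => simp [nest_gen]
    | succ N ih =>
      rw [pow_succ', mul_assoc, nest_gen_mul g i (hN N), ih, pow_succ', Module.End.mul_apply,
        LieAlgebra.ad_apply]
  have h2 := map_nest (LieModule.toEnd ℂ 𝔤 M).toLinearMap (fun a b => LieHom.map_lie _ a b) g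
    (gen i ^ (1 - C.A i j).toNat * gen j)
  have h3 := map_nest (act fun i => LieModule.toEnd ℂ 𝔤 M (g i)).toLinearMap
    (fun a b => by simp [Ring.lie_def]) gen (gen i ^ (1 - C.A i j).toNat * gen j)
  rw [h1, hg, map_zero] at h2
  simp only [AlgHom.toLinearMap_apply, act_gen] at h3
  rw [serre, Y, h3]
  exact h2.symm

theorem act_neg_serre {i j : ι} (hij : i ≠ j) :
    act (fun i => -LieModule.toEnd ℂ 𝔤 M (R.e i)) (serre C i j) = 0 := by
  have := act_serre (C := C) M (g := fun i => -R.e i) (i := i) (j := j) (by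
    rw [map_neg, map_neg, neg_pow, Module.End.mul_apply, R.serre_e i j hij, map_zero, neg_zero])
  simpa only [map_neg] using this

theorem isTriple_toEnd : IsTriple C (fun i => LieModule.toEnd ℂ 𝔤 M (R.e i))
    (fun i => LieModule.toEnd ℂ 𝔤 M (R.f i))
    (fun i => LieModule.toEnd ℂ 𝔤 M (R.coroot i : 𝔤)) where
  e_f i j x := by
    simp only [LieModule.toEnd_apply_apply]
    rw [leibniz_lie, R.e_f, add_comm]
    split_ifs <;> simp
  h_f i j x := by
    simp only [LieModule.toEnd_apply_apply]
    rw [leibniz_lie, R.coroot_f, smul_lie]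
    module
  serre i j hij := act_serre M (R.serre_f i j hij)

variable {M}

theorem lie_mem_of_generators {S : Submodule ℂ M} (he : ∀ i, ∀ m ∈ S, ⁅R.e i, m⁆ ∈ S)
    (hf : ∀ i, ∀ m ∈ S, ⁅R.f i, m⁆ ∈ S) (hh : ∀ h : R.H, ∀ m ∈ S, ⁅(h : 𝔤), m⁆ ∈ S) (x : 𝔤) :
    ∀ m ∈ S, ⁅x, m⁆ ∈ S := by
  let L : LieSubalgebra ℂ 𝔤 :=
    { carrier := {x | ∀ m ∈ S, ⁅x, m⁆ ∈ S}
      zero_mem' := fun m _ => by simp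
      add_mem' := fun {a b} ha hb m hm => by rw [add_lie]; exact S.add_mem (ha m hm) (hb m hm)
      smul_mem' := fun c a ha m hm => by rw [smul_lie]; exact S.smul_mem c (ha m hm)
      lie_mem' := fun {a b} ha hb m hm => by
        rw [lie_lie]; exact S.sub_mem (ha _ (hb m hm)) (hb _ (ha m hm)) }
  have hL : LieSubalgebra.lieSpan ℂ 𝔤 (Set.range R.e ∪ Set.range R.f ∪ (R.H : Set 𝔤)) ≤ L := by
    rw [LieSubalgebra.lieSpan_le]
    rintro _ ((⟨i, rfl⟩ | ⟨i, rfl⟩) | hx)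
    · exact he i
    · exact hf i
    · exact hh ⟨_, hx⟩
  rw [R.generates] at hL
  exact hL (LieSubalgebra.mem_top x)

theorem map_lie_of_generators {N : Type} [AddCommGroup N] [Module ℂ N] [LieRingModule 𝔤 N]
    [LieModule ℂ 𝔤 N] (φ : M →ₗ[ℂ] N) (he : ∀ i m, φ ⁅R.e i, m⁆ = ⁅R.e i, φ m⁆)
    (hf : ∀ i m, φ ⁅R.f i, m⁆ = ⁅R.f i, φ m⁆)
    (hh : ∀ (h : R.H) (m : M), φ ⁅(h : 𝔤), m⁆ = ⁅(h : 𝔤), φ m⁆) (x : 𝔤) :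
    ∀ m, φ ⁅x, m⁆ = ⁅x, φ m⁆ := by
  let L : LieSubalgebra ℂ 𝔤 :=
    { carrier := {x | ∀ m, φ ⁅x, m⁆ = ⁅x, φ m⁆}
      zero_mem' := fun m => by simp
      add_mem' := fun {a b} ha hb m => by rw [add_lie, add_lie, map_add, ha, hb]
      smul_mem' := fun c a ha m => by rw [smul_lie, smul_lie, map_smul, ha]
      lie_mem' := fun {a b} ha hb m => by rw [lie_lie, lie_lie, map_sub, ha, hb m, hb, ha] }
  have hL : LieSubalgebra.lieSpan ℂ 𝔤 (Set.range R.e ∪ Set.range R.f ∪ (R.H : Set 𝔤)) ≤ L := by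
    rw [LieSubalgebra.lieSpan_le]
    rintro _ ((⟨i, rfl⟩ | ⟨i, rfl⟩) | hx)
    · exact he i
    · exact hf i
    · exact hh ⟨_, hx⟩
  rw [R.generates] at hL
  exact hL (LieSubalgebra.mem_top x)

/-- The orbit map of a vector for the free algebra acting by the lowering operators. -/
noncomputable def orbit (v : M) : Free ι →ₗ[ℂ] M :=
  LinearMap.applyₗ v ∘ₗ (act fun i => LieModule.toEnd ℂ 𝔤 M (R.f i)).toLinearMap

theorem orbit_apply (v : M) (x : Free ι) :
    orbit R v x = act (fun i => LieModule.toEnd ℂ 𝔤 M (R.f i)) x v := rfl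

theorem orbit_one (v : M) : orbit R v 1 = v := by simp [orbit_apply]

theorem lie_f_orbit (v : M) (i : ι) (x : Free ι) :
    ⁅R.f i, orbit R v x⁆ = orbit R v (gen i * x) := by
  rw [orbit_apply, orbit_apply, act_gen_mul, LieModule.toEnd_apply_apply]

/-- A singular vector of weight `l`. -/
structure IsSingular (l : Module.Dual ℂ R.H) (v : M) : Prop where
  e : ∀ i, ⁅R.e i, v⁆ = 0
  h : ∀ h : R.H, ⁅(h : 𝔤), v⁆ = l h • v

variable {R} {l : Module.Dual ℂ R.H} {v : M} {n : ι → ℕ}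

theorem IsSingular.coroot (hv : IsSingular R l v) (hn : ∀ i, l (R.coroot i) = n i) (i : ι) :
    LieModule.toEnd ℂ 𝔤 M (R.coroot i : 𝔤) v = (n i : ℂ) • v := by
  rw [LieModule.toEnd_apply_apply, hv.h, hn]

theorem IsSingular.lie_e_orbit (hv : IsSingular R l v) (hn : ∀ i, l (R.coroot i) = n i) (i : ι)
    (x : Free ι) : ⁅R.e i, orbit R v x⁆ = orbit R v (eop C (fun i => n i) i x) :=
  (isTriple_toEnd R M).e_act (hv.coroot hn) hv.e i x

theorem IsSingular.lie_h_orbit (hv : IsSingular R l v) {h : R.H} {a : ι → ℂ}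
    (ha : ∀ j, ⁅(h : 𝔤), R.f j⁆ = (-a j) • R.f j) (x : Free ι) :
    ⁅(h : 𝔤), orbit R v x⁆ = l h • orbit R v x - orbit R v (wtOp a x) := by
  have := map_act (fun i => LieModule.toEnd ℂ 𝔤 M (R.f i)) (LieModule.toEnd ℂ 𝔤 M (h : 𝔤))
    (a := fun i => -a i) (l := l h) (u := v)
    (fun i x => by
      simp only [LieModule.toEnd_apply_apply]; rw [leibniz_lie, ha, smul_lie, add_comm])
    (hv.h h) x
  have hw : wtOp (fun i => -a i) x = -wtOp a x := by
    refine eq_of_mem_wspan (f := wtOp fun i => -a i) (g := -wtOp a) (fun w _ => ?_)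
      (mem_wspan_true x)
    simp only [wtOp, wlift_wd, LinearMap.neg_apply]
    rw [← neg_smul]
    congr 1
    induction w with
    | nil => simp
    | cons i w ih =>
      rw [List.map_cons, List.sum_cons, ih, List.map_cons, List.sum_cons, neg_add]
  rw [hw, map_neg, LinearMap.neg_apply, ← sub_eq_add_neg] at this
  exact this

theorem IsSingular.orbit_surjective (hv : IsSingular R l v) (hn : ∀ i, l (R.coroot i) = n i)
    (hv0 : v ≠ 0) (hM : IsSimpleOrder (LieSubmodule ℂ 𝔤 M)) :
    Function.Surjective (orbit R v) := by
  let S : LieSubmodule ℂ 𝔤 M :=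
    { LinearMap.range (orbit R v) with
      lie_mem := fun {x m} hm => by
        refine lie_mem_of_generators R (S := LinearMap.range (orbit R v)) ?_ ?_ ?_ x m hm
        · rintro i _ ⟨x, rfl⟩
          exact ⟨_, (hv.lie_e_orbit hn i x).symm⟩
        · rintro i _ ⟨x, rfl⟩
          exact ⟨_, (lie_f_orbit R v i x).symm⟩
        · rintro h _ ⟨x, rfl⟩
          obtain ⟨a, ha⟩ := exists_root R h
          exact ⟨l h • x - wtOp a x, by
            rw [hv.lie_h_orbit fun j => (ha j).2, map_sub, map_smul]⟩ }
  have hvS : v ∈ S := ⟨1, orbit_one R v⟩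
  rcases hM.eq_bot_or_eq_top S with h | h
  · rw [h] at hvS
    exact absurd ((LieSubmodule.mem_bot v).1 hvS) hv0
  · intro m
    have : m ∈ S := h ▸ LieSubmodule.mem_top m
    exact this

theorem IsSingular.orbit_eq_zero (hv : IsSingular R l v) (hn : ∀ i, l (R.coroot i) = n i)
    (hf : ∀ i, ∃ k, ((LieModule.toEnd ℂ 𝔤 M (R.f i)) ^ k) v = 0) {x : Free ι}
    (hx : x ∈ hwIdeal C n) : orbit R v x = 0 :=
  (isTriple_toEnd R M).act_eq_zero (hv.coroot hn) hv.e hf hx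

theorem IsSingular.orbit_eq_zero_iff (hv : IsSingular R l v) (hn : ∀ i, l (R.coroot i) = n i)
    (hf : ∀ i, ∃ k, ((LieModule.toEnd ℂ 𝔤 M (R.f i)) ^ k) v = 0) (hv0 : v ≠ 0) (x : Free ι) :
    orbit R v x = 0 ↔ x ∈ hwIdeal C n :=
  (isTriple_toEnd R M).act_eq_zero_iff (hv.coroot hn) hv.e hf hv0 x

theorem mem_hWeightSpace {χ : Module.Dual ℂ R.H} {m : M} :
    m ∈ hWeightSpace R χ M ↔ ∀ h : R.H, ⁅(h : 𝔤), m⁆ = χ h • m := by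
  simp [hWeightSpace, Submodule.mem_iInf, sub_eq_zero]

end Module

section Tensor

variable {V W : Type} [AddCommGroup V] [Module ℂ V] [LieRingModule 𝔤 V] [LieModule ℂ 𝔤 V]
  [AddCommGroup W] [Module ℂ W] [LieRingModule 𝔤 W] [LieModule ℂ 𝔤 W]

theorem tensor_nilpotent (x : 𝔤) (hV : ∀ m : V, ∃ k, ((LieModule.toEnd ℂ 𝔤 V x) ^ k) m = 0)
    (hW : ∀ m : W, ∃ k, ((LieModule.toEnd ℂ 𝔤 W x) ^ k) m = 0) (z : V ⊗[ℂ] W) :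
    ∃ k, ((LieModule.toEnd ℂ 𝔤 (V ⊗[ℂ] W) x) ^ k) z = 0 := by
  have hbot : ∀ z ∈ (⊥ : Submodule ℂ (V ⊗[ℂ] W)),
      LieModule.toEnd ℂ 𝔤 (V ⊗[ℂ] W) x z ∈ (⊥ : Submodule ℂ (V ⊗[ℂ] W)) := fun z hz => by
    rw [(Submodule.mem_bot ℂ).1 hz, map_zero]; exact zero_mem _
  suffices h : z ∈ nilSub (LieModule.toEnd ℂ 𝔤 (V ⊗[ℂ] W) x) ⊥ hbot from
    Exists.imp (fun k hk => (Submodule.mem_bot ℂ).1 hk) h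
  induction z with
  | zero => exact zero_mem _
  | add a b ha hb => exact add_mem ha hb
  | tmul a b =>
    obtain ⟨p, hp⟩ := hV a
    obtain ⟨q, hq⟩ := hW b
    exact ⟨p + q, leibniz_pow_mem (TensorProduct.mk ℂ V W) (S₁ := ⊥) (S₂ := ⊥)
      (fun a b => TensorProduct.LieModule.lie_tmul_right x a b)
      (fun a ha b => by simp [(Submodule.mem_bot ℂ).1 ha])
      (fun a b hb => by simp [(Submodule.mem_bot ℂ).1 hb]) hbot p q a b hp hq⟩

theorem contractFst_lie (ξ : V →ₗ[ℂ] ℂ) (x : 𝔤) (z : V ⊗[ℂ] W) :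
    contractFst ξ ⁅x, z⁆ =
      contractFst (ξ ∘ₗ (LieModule.toEnd ℂ 𝔤 V x : Module.End ℂ V)) z +
        ⁅x, contractFst ξ z⁆ := by
  induction z with
  | zero => simp
  | add a b ha hb => simp only [lie_add, map_add, ha, hb]; abel
  | tmul a b =>
    rw [TensorProduct.LieModule.lie_tmul_right, map_add]
    simp [contractFst_tmul]

theorem contractFst_pow {x : 𝔤} {z : V ⊗[ℂ] W} (hz : ⁅x, z⁆ = 0) (ξ : V →ₗ[ℂ] ℂ) (k : ℕ) :
    contractFst (ξ ∘ₗ (LieModule.toEnd ℂ 𝔤 V x ^ k : Module.End ℂ V)) z =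
      (-1 : ℂ) ^ k • ((LieModule.toEnd ℂ 𝔤 W x) ^ k) (contractFst ξ z) := by
  induction k generalizing ξ with
  | zero => simp [Module.End.one_eq_id]
  | succ k ih =>
    have h := contractFst_lie ξ x z
    rw [hz, map_zero, eq_comm, add_eq_zero_iff_eq_neg] at h
    rw [pow_succ' (LieModule.toEnd ℂ 𝔤 V x), Module.End.mul_eq_comp, ← LinearMap.comp_assoc, ih, h,
      pow_succ (LieModule.toEnd ℂ 𝔤 W x), Module.End.mul_apply, map_neg, pow_succ]
    simp

theorem contractFst_word_eq_zero {R : KacMoodyRealization ι C 𝔤} {z : V ⊗[ℂ] W}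
    (hz : ∀ i, ⁅R.e i, z⁆ = 0) (w : List ι)
    {ξ : V →ₗ[ℂ] ℂ} (hξ : contractFst ξ z = 0) :
    contractFst (ξ ∘ₗ (act (fun i => LieModule.toEnd ℂ 𝔤 V (R.e i)) (wd w))) z = 0 := by
  induction w generalizing ξ with
  | nil => simpa [Module.End.one_eq_id] using hξ
  | cons i w ih =>
    rw [wd_cons, map_mul, act_gen, Module.End.mul_eq_comp, ← LinearMap.comp_assoc]
    refine ih ?_
    have h := contractFst_lie ξ (R.e i) z
    rw [hz, hξ, lie_zero, map_zero, add_zero] at h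
    exact h.symm

end Tensor

end Realization

section Multiplicity

variable {R : KacMoodyRealization ι C 𝔤} {V W : Type}
  [AddCommGroup V] [Module ℂ V] [LieRingModule 𝔤 V] [LieModule ℂ 𝔤 V]
  [AddCommGroup W] [Module ℂ W] [LieRingModule 𝔤 W] [LieModule ℂ 𝔤 W]
  {l l' : Module.Dual ℂ R.H} {v : V} {n : ι → ℕ} {ξ : V →ₗ[ℂ] ℂ}

theorem contractFst_mem (hv : IsSingular R l v) (hn : ∀ i, l (R.coroot i) = n i)
    (hs : Function.Surjective (orbit R v)) (hξ : ∀ x, ξ (orbit R v x) = eps x) {z : V ⊗[ℂ] W}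
    (hz : IsSingular R l' z) :
    contractFst ξ z ∈ (hWeightSpace R (l' - l) W) ⊓
      ⨅ i : ι, LinearMap.ker ((LieModule.toEnd ℂ 𝔤 W (R.e i)) ^ (n i + 1)) := by
  refine ⟨mem_hWeightSpace.2 fun h => ?_, ?_⟩
  · obtain ⟨a, ha⟩ := exists_root R h
    have h1 : ξ ∘ₗ (LieModule.toEnd ℂ 𝔤 V (h : 𝔤) : Module.End ℂ V) = l h • ξ := by
      ext m
      obtain ⟨x, rfl⟩ := hs m
      rw [LinearMap.comp_apply, LieModule.toEnd_apply_apply, hv.lie_h_orbit fun j => (ha j).2,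
        map_sub, hξ, eps_wtOp, sub_zero, map_smul, LinearMap.smul_apply]
    have h2 := contractFst_lie ξ (h : 𝔤) z
    rw [h1, contractFst_smul, hz.h, map_smul] at h2
    rw [LinearMap.sub_apply, sub_smul, h2]
    abel
  · rw [SetLike.mem_coe, Submodule.mem_iInf]
    intro i
    rw [LinearMap.mem_ker]
    have h1 := contractFst_pow (hz.e i) ξ (n i + 1)
    have h2 : ξ ∘ₗ (LieModule.toEnd ℂ 𝔤 V (R.e i) ^ (n i + 1) : Module.End ℂ V) = 0 := by
      ext m
      obtain ⟨x, rfl⟩ := hs m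
      have h3 : ∀ k : ℕ, (LieModule.toEnd ℂ 𝔤 V (R.e i) ^ k) (orbit R v x) =
          orbit R v ((eop C (fun i => (n i : ℂ)) i ^ k) x) := by
        intro k
        induction k with
        | zero => simp
        | succ k ih =>
          rw [pow_succ', Module.End.mul_apply, ih, LieModule.toEnd_apply_apply, hv.lie_e_orbit hn,
            pow_succ', Module.End.mul_apply]
      rw [LinearMap.comp_apply, h3, hξ, eps_eop_pow, LinearMap.zero_apply]
    have h4 : contractFst (0 : V →ₗ[ℂ] ℂ) z = 0 := by
      simpa using contractFst_smul 0 (0 : V →ₗ[ℂ] ℂ) z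
    rw [h2, h4, eq_comm, smul_eq_zero] at h1
    exact h1.resolve_left (by simp)

theorem eq_zero_of_singular (hv : IsSingular R l v) (hn : ∀ i, l (R.coroot i) = n i)
    (hf : ∀ i, ∃ k, ((LieModule.toEnd ℂ 𝔤 V (R.f i)) ^ k) v = 0)
    (hs : Function.Surjective (orbit R v)) (hξ : ∀ x, ξ (orbit R v x) = eps x) {z : V ⊗[ℂ] W}
    (hz : ∀ i, ⁅R.e i, z⁆ = 0) (h0 : contractFst ξ z = 0) : z = 0 := by
  refine eq_zero_of_contractFst (Ξ := Set.range fun w : List ι =>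
    ξ ∘ₗ (act (fun i => LieModule.toEnd ℂ 𝔤 V (R.e i)) (wd w))) (fun a ha => ?_) ?_
  · obtain ⟨x, rfl⟩ := hs a
    refine hv.orbit_eq_zero hn hf (mem_hwIdeal_of_eps n fun w => ?_)
    have h1 := ha _ ⟨w, rfl⟩
    rw [LinearMap.comp_apply, orbit_apply,
      (isTriple_toEnd R V).e_word_act (hv.coroot hn) hv.e, ← orbit_apply, hξ] at h1
    exact h1
  · rintro _ ⟨w, rfl⟩
    exact contractFst_word_eq_zero hz w h0

theorem exists_singular (hv : IsSingular R l v) (hn : ∀ i, l (R.coroot i) = n i)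
    (hf : ∀ i, ∃ k, ((LieModule.toEnd ℂ 𝔤 V (R.f i)) ^ k) v = 0)
    (hξ : ∀ x, ξ (orbit R v x) = eps x) {u : W}
    (hu : u ∈ (hWeightSpace R (l' - l) W) ⊓
      ⨅ i : ι, LinearMap.ker ((LieModule.toEnd ℂ 𝔤 W (R.e i)) ^ (n i + 1)))
    {N : ℕ} (hN : ∀ w : List ι, N ≤ w.length →
      act (fun i => LieModule.toEnd ℂ 𝔤 W (R.e i)) (wd w) u = 0) :
    ∃ z : V ⊗[ℂ] W, IsSingular R l' z ∧ contractFst ξ z = u := by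
  obtain ⟨hu1, hu2⟩ := hu
  rw [SetLike.mem_coe, mem_hWeightSpace] at hu1
  rw [SetLike.mem_coe, Submodule.mem_iInf] at hu2
  obtain ⟨z, hz1, hz2, hz3⟩ := exists_canonical (C := C) (n := n)
    (f := fun i => LieModule.toEnd ℂ 𝔤 V (R.f i))
    (g := fun i => -LieModule.toEnd ℂ 𝔤 W (R.e i)) (v := v) (u := u)
    (fun x hx => hv.orbit_eq_zero hn hf hx)
    (fun x hx => act_hwIdeal (fun i j hij => act_neg_serre R W hij) (fun i => by
      rw [neg_pow, Module.End.mul_apply, LinearMap.mem_ker.1 (hu2 i), map_zero]) hx)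
    (N := N) (fun w hw => by rw [act_neg_wd, LinearMap.smul_apply, hN w hw, smul_zero])
  refine ⟨z, ⟨fun i => ?_, fun h => ?_⟩, hz1 ξ hξ⟩
  · exact hz2 i (LieModule.toEnd ℂ 𝔤 V (R.e i)) (LieModule.toEnd ℂ 𝔤 (V ⊗[ℂ] W) (R.e i))
      (fun x => hv.lie_e_orbit hn i x) (fun a b => by
        rw [LieModule.toEnd_apply_apply, TensorProduct.LieModule.lie_tmul_right,
          LinearMap.neg_apply, tmul_neg, sub_neg_eq_add]
        rfl)
  · obtain ⟨a, ha⟩ := exists_root R h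
    have := hz3 a (LieModule.toEnd ℂ 𝔤 V (h : 𝔤)) (LieModule.toEnd ℂ 𝔤 W (h : 𝔤))
      (LieModule.toEnd ℂ 𝔤 (V ⊗[ℂ] W) (h : 𝔤)) (l h) ((l' - l) h)
      (fun x => hv.lie_h_orbit (fun j => (ha j).2) x)
      (map_act (fun i => -LieModule.toEnd ℂ 𝔤 W (R.e i)) _ (fun i x => by
        simp only [LieModule.toEnd_apply_apply, LinearMap.neg_apply, lie_neg]
        rw [leibniz_lie, (ha i).1, smul_lie]
        module) (hu1 h))
      (fun a b => TensorProduct.LieModule.lie_tmul_right _ a b)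
    rw [LinearMap.sub_apply, add_sub_cancel] at this
    exact this

theorem exists_gModHom (hv : IsSingular R l v) (hn : ∀ i, l (R.coroot i) = n i)
    (hf : ∀ i, ∃ k, ((LieModule.toEnd ℂ 𝔤 V (R.f i)) ^ k) v = 0) (hv0 : v ≠ 0)
    (hs : Function.Surjective (orbit R v)) {z : W} (hz : IsSingular R l z)
    (hfz : ∀ i, ∃ k, ((LieModule.toEnd ℂ 𝔤 W (R.f i)) ^ k) z = 0) :
    ∃ φ ∈ gModHom 𝔤 V W, φ v = z := by
  obtain ⟨φ, hφ⟩ := exists_factor hs (orbit R z)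
    fun x hx => hz.orbit_eq_zero hn hfz ((hv.orbit_eq_zero_iff hn hf hv0 x).1 hx)
  refine ⟨φ, map_lie_of_generators R φ (fun i m => ?_) (fun i m => ?_) (fun h m => ?_), ?_⟩
  · obtain ⟨x, rfl⟩ := hs m
    rw [hv.lie_e_orbit hn, hφ, hφ, hz.lie_e_orbit hn]
  · obtain ⟨x, rfl⟩ := hs m
    rw [lie_f_orbit, hφ, hφ, lie_f_orbit]
  · obtain ⟨x, rfl⟩ := hs m
    obtain ⟨a, ha⟩ := exists_root R h
    rw [hv.lie_h_orbit fun j => (ha j).2, map_sub, map_smul, hφ, hφ,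
      hz.lie_h_orbit fun j => (ha j).2]
  · have := hφ 1
    rwa [orbit_one, orbit_one] at this

theorem gModHom_eq_zero (hs : Function.Surjective (orbit R v)) {φ : V →ₗ[ℂ] W}
    (hφ : φ ∈ gModHom 𝔤 V W) (h0 : φ v = 0) : φ = 0 := by
  ext m
  obtain ⟨x, rfl⟩ := hs m
  refine eq_of_mem_wspan (f := φ ∘ₗ orbit R v) (g := 0) (fun w _ => ?_) (mem_wspan_true x)
  rw [LinearMap.comp_apply, LinearMap.zero_apply]
  induction w with
  | nil => rw [wd_nil, orbit_one, h0]
  | cons i w ih => rw [wd_cons, ← lie_f_orbit, hφ, ih, lie_zero]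

end Multiplicity

end KacMoody

/-- **Kostant-type multiplicity formula.** For a symmetrizable Kac–Moody
algebra `𝔤` and dominant integral weights `λ, μ, ν`, the multiplicity of `V(ν)` in
`V(λ) ⊗ V(μ)` equals the dimension of
`{v ∈ V(μ)_{ν-λ} : e_i^{λ(α_i^∨)+1} · v = 0 for all i}`. -/
theorem kostant_type_multiplicity
    (R : KacMoodyRealization ι C 𝔤)
    (lam mu nu : Module.Dual ℂ R.H)
    (hlam : DominantIntegral R lam) (hmu : DominantIntegral R mu)
    (hnu : DominantIntegral R nu)
    (nlam : ι → ℕ) (hnlam : ∀ i, lam (R.coroot i) = (nlam i : ℂ))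
    (V1 V2 V3 : Type)
    [AddCommGroup V1] [Module ℂ V1] [LieRingModule 𝔤 V1] [LieModule ℂ 𝔤 V1]
    [AddCommGroup V2] [Module ℂ V2] [LieRingModule 𝔤 V2] [LieModule ℂ 𝔤 V2]
    [AddCommGroup V3] [Module ℂ V3] [LieRingModule 𝔤 V3] [LieModule ℂ 𝔤 V3]
    (v1 : V1) (v2 : V2) (v3 : V3)
    (h1 : IsIntegrableHW R lam V1 v1) (h2 : IsIntegrableHW R mu V2 v2)
    (h3 : IsIntegrableHW R nu V3 v3) :
    Module.finrank ℂ (gModHom 𝔤 V3 (V1 ⊗[ℂ] V2)) =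
      Module.finrank ℂ
        ↥((hWeightSpace R (nu - lam) V2) ⊓
          ⨅ i : ι, LinearMap.ker ((LieModule.toEnd ℂ 𝔤 V2 (R.e i)) ^ (nlam i + 1))) := by
  open KacMoody in
  choose nmu hnmu using hmu
  choose nnu hnnu using hnu
  obtain ⟨hv1, he1, hh1, -, hf1, hs1⟩ := h1
  obtain ⟨hv2, he2, hh2, -, hf2, hs2⟩ := h2
  obtain ⟨hv3, he3, hh3, -, hf3, hs3⟩ := h3
  have S1 : IsSingular R lam v1 := ⟨he1, hh1⟩
  have S2 : IsSingular R mu v2 := ⟨he2, hh2⟩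
  have S3 : IsSingular R nu v3 := ⟨he3, hh3⟩
  have surj1 := S1.orbit_surjective hnlam hv1 hs1
  have surj2 := S2.orbit_surjective hnmu hv2 hs2
  have surj3 := S3.orbit_surjective hnnu hv3 hs3
  have hF1 := fun i => hf1 i v1
  have hF3 := fun i => hf3 i v3
  obtain ⟨ξ, hξ⟩ := exists_factor surj1 eps fun x hx =>
    eps_hwIdeal nlam ((S1.orbit_eq_zero_iff hnlam hF1 hv1 x).1 hx)
  have hsing : ∀ φ ∈ gModHom 𝔤 V3 (V1 ⊗[ℂ] V2), IsSingular R nu (φ v3) := fun φ hφ =>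
    ⟨fun i => by rw [← hφ, he3, map_zero], fun h => by rw [← hφ, hh3, map_smul]⟩
  let Ψ : gModHom 𝔤 V3 (V1 ⊗[ℂ] V2) →ₗ[ℂ] ↥((hWeightSpace R (nu - lam) V2) ⊓
      ⨅ i : ι, LinearMap.ker ((LieModule.toEnd ℂ 𝔤 V2 (R.e i)) ^ (nlam i + 1))) :=
    LinearMap.codRestrict _
      (contractFst ξ ∘ₗ LinearMap.applyₗ v3 ∘ₗ (gModHom 𝔤 V3 (V1 ⊗[ℂ] V2)).subtype)
      fun φ => contractFst_mem S1 hnlam surj1 hξ (hsing φ φ.2)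
  refine (LinearEquiv.ofBijective Ψ ⟨fun φ φ' h => ?_, fun u => ?_⟩).finrank_eq
  · have hsub := sub_mem φ.2 φ'.2
    have h0 : contractFst ξ (φ.1 v3) = contractFst ξ (φ'.1 v3) := congrArg Subtype.val h
    refine Subtype.ext (sub_eq_zero.1 (gModHom_eq_zero surj3 hsub
      (eq_zero_of_singular S1 hnlam hF1 surj1 hξ (hsing _ hsub).e ?_)))
    rw [LinearMap.sub_apply, map_sub, h0, sub_self]
  · obtain ⟨x, hx⟩ := surj2 u
    obtain ⟨N, hN⟩ := mem_locNil_eop (C := C) (fun i => (nmu i : ℂ)) x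
    obtain ⟨z, hz, hzu⟩ := exists_singular S1 hnlam hF1 hξ u.2 (N := N) fun w hw => by
      rw [← hx, orbit_apply, (isTriple_toEnd R V2).e_word_act (S2.coroot hnmu) he2, hN w hw,
        map_zero, LinearMap.zero_apply]
    obtain ⟨φ, hφ, hφz⟩ := exists_gModHom S3 hnnu hF3 hv3 surj3 hz
      fun i => tensor_nilpotent _ (hf1 i) (hf2 i) z
    exact ⟨⟨φ, hφ⟩, Subtype.ext (by
      change contractFst ξ (φ v3) = u
      rw [hφz, hzu])⟩
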